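/- Let n ≥ 3, 0 < α < 1, λ, κ > 1, C₀ ≥ 1, c₀ ≥ 1. There exist constants C = C(n,λ,κ,α,C₀,c₀) > 0 and ϰ = ϰ(α) > 2 with the following property. Let (a,b) ∈ 𝒟(λ,κ), ξ ∈ ℝⁿ, and let u be twice continuously differentiable on ℝⁿ∖{ξ} with second derivatives locally α-Hölder continuous, satisfying −div(a∇u) + b u = 0 pointwise on ℝⁿ∖{ξ} and |u(x)| ≤ C₀ e^{−|x−ξ|/√(c₀κ)} |x−ξ|^{2−n} for all x ≠ ξ. Then for every bounded open set 𝒪 whose closure does not contain ξ, ‖u‖_{C^{2,α}(closure of 𝒪)} ≤ C Λ(d+ϱ)^ϰ max(ϱ^{−(2+α)}, 1) ϱ^{2−n}, where ϱ = dist(ξ, closure of 𝒪), d = diam(𝒪) and Λ(h) = [1 + h(1+h)(1+h^α)]λ. -/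

import Mathlib

open MeasureTheory Metric Set ENNReal

noncomputable section

abbrev Euc (n : ℕ) := EuclideanSpace ℝ (Fin n)

noncomputable def vdiv {n : ℕ} (F : Euc n → Euc n) (x : Euc n) : ℝ :=
  ∑ i, fderiv ℝ F x (EuclideanSpace.single i 1) i

noncomputable def pd {n : ℕ} (i : Fin n) (f : Euc n → ℝ) : Euc n → ℝ :=
  fun x => fderiv ℝ f x (EuclideanSpace.single i 1)

noncomputable def supAbs {n : ℕ} (K : Set (Euc n)) (f : Euc n → ℝ) : ℝ≥0∞ :=
  ⨆ x ∈ K, ENNReal.ofReal |f x|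

noncomputable def holderSemi {n : ℕ} (α : ℝ) (K : Set (Euc n)) (f : Euc n → ℝ) : ℝ≥0∞ :=
  ⨆ x ∈ K, ⨆ y ∈ K, ENNReal.ofReal (|f x - f y| / dist x y ^ α)

noncomputable def C2alphaNorm {n : ℕ} (α : ℝ) (K : Set (Euc n)) (w : Euc n → ℝ) : ℝ≥0∞ :=
  supAbs K w + (∑ i, supAbs K (pd i w)) + (∑ i, ∑ j, supAbs K (pd i (pd j w)))
    + ∑ i, ∑ j, holderSemi α K (pd i (pd j w))

def InD {n : ℕ} (lam kap : ℝ) (a b : Euc n → ℝ) : Prop :=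
  ContDiff ℝ 1 a ∧ (∀ x, lam⁻¹ ≤ a x) ∧
  (∃ A₀ A₁ L : ℝ, (∀ x, |a x| ≤ A₀) ∧ (∀ x, ‖fderiv ℝ a x‖ ≤ A₁) ∧
      (∀ x y, ‖fderiv ℝ a x - fderiv ℝ a y‖ ≤ L * ‖x - y‖) ∧ A₀ + A₁ + L ≤ lam) ∧
  (∀ x, kap⁻¹ ≤ b x) ∧
  (∃ B₀ L' : ℝ, (∀ x, |b x| ≤ B₀) ∧ (∀ x y, |b x - b y| ≤ L' * ‖x - y‖) ∧ B₀ + L' ≤ kap)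

noncomputable def Lam (lam α h : ℝ) : ℝ := (1 + h * (1 + h) * (1 + h ^ α)) * lam

/-! ### Partial derivatives -/

section PartialDerivatives

variable {n : ℕ}

theorem contDiff_pd {k m : WithTop ℕ∞} {f : Euc n → ℝ} (hf : ContDiff ℝ k f) (h : m + 1 ≤ k)
    (i : Fin n) : ContDiff ℝ m (pd i f) :=
  (hf.fderiv_right h).clm_apply contDiff_const

theorem tsupport_pd_subset (f : Euc n → ℝ) (i : Fin n) : tsupport (pd i f) ⊆ tsupport f :=
  tsupport_fderiv_apply_subset ℝ _

theorem hasCompactSupport_pd {f : Euc n → ℝ} (hf : HasCompactSupport f) (i : Fin n) :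
    HasCompactSupport (pd i f) :=
  hf.of_isClosed_subset (isClosed_tsupport _) (tsupport_pd_subset f i)

theorem fderiv_apply_eq_sum_pd (f : Euc n → ℝ) (x z : Euc n) :
    fderiv ℝ f x z = ∑ k, z k * pd k f x := by
  have hz : z = ∑ k, z k • (EuclideanSpace.single k (1 : ℝ) : Euc n) := by
    ext j
    simp [Finset.sum_apply, Pi.single_apply]
  conv_lhs => rw [hz]
  simp [pd, map_sum, map_smul]

theorem norm_fderiv_le_sum_pd (f : Euc n → ℝ) (x : Euc n) :
    ‖fderiv ℝ f x‖ ≤ ∑ k, |pd k f x| := by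
  refine ContinuousLinearMap.opNorm_le_bound _ (Finset.sum_nonneg fun _ _ => abs_nonneg _) ?_
  intro z
  rw [fderiv_apply_eq_sum_pd, Finset.sum_mul]
  refine (Finset.abs_sum_le_sum_abs _ _).trans (Finset.sum_le_sum fun k _ => ?_)
  rw [abs_mul, mul_comm]
  gcongr
  exact PiLp.norm_apply_le z k

theorem abs_pd_le_norm_fderiv (f : Euc n → ℝ) (x : Euc n) (k : Fin n) :
    |pd k f x| ≤ ‖fderiv ℝ f x‖ := by
  simpa [pd] using (fderiv ℝ f x).le_opNorm (EuclideanSpace.single k 1)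

theorem pd_pd_eq {f : Euc n → ℝ} (x : Euc n) (hf : ContDiffAt ℝ 2 f x) (i j : Fin n) :
    pd i (pd j f) x
      = fderiv ℝ (fderiv ℝ f) x (EuclideanSpace.single i 1) (EuclideanSpace.single j 1) := by
  have hd : DifferentiableAt ℝ (fderiv ℝ f) x :=
    (hf.fderiv_right (m := 1) (by norm_num)).differentiableAt (by norm_num)
  unfold pd
  rw [fderiv_clm_apply hd (by fun_prop)]
  simp

theorem pd_comm {f : Euc n → ℝ} (hf : ContDiff ℝ 2 f) (i j : Fin n) :
    pd i (pd j f) = pd j (pd i f) := by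
  funext x
  rw [pd_pd_eq x hf.contDiffAt, pd_pd_eq x hf.contDiffAt]
  exact hf.contDiffAt.isSymmSndFDerivAt (by simp) _ _

theorem pd_congr_of_eventuallyEq {f g : Euc n → ℝ} {x : Euc n} (h : f =ᶠ[nhds x] g) (i : Fin n) :
    pd i f x = pd i g x := by
  unfold pd
  rw [h.fderiv_eq]

theorem pd_eventuallyEq {f g : Euc n → ℝ} {x : Euc n} (h : f =ᶠ[nhds x] g) (i : Fin n) :
    pd i f =ᶠ[nhds x] pd i g := by
  filter_upwards [h.eventuallyEq_nhds] with y hy using pd_congr_of_eventuallyEq hy i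

theorem pd_mul {f g : Euc n → ℝ} {x : Euc n} (hf : DifferentiableAt ℝ f x)
    (hg : DifferentiableAt ℝ g x) (i : Fin n) :
    pd i (fun y => f y * g y) x = f x * pd i g x + g x * pd i f x := by
  unfold pd
  rw [fderiv_fun_mul hf hg]
  simp

theorem pd_coord (i k : Fin n) (x : Euc n) :
    pd i (fun y : Euc n => y k) x = if i = k then 1 else 0 := by
  have : (fun y : Euc n => y k) = (EuclideanSpace.proj k : Euc n →L[ℝ] ℝ) := rfl
  unfold pd
  rw [this, ContinuousLinearMap.fderiv]
  simp [eq_comm]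

end PartialDerivatives

/-! ### Averages against rescaled test functions -/

section ScaledAverages

variable {n : ℕ}

/-- Smooth functions supported in the closed unit ball. -/
structure IsTest (φ : Euc n → ℝ) : Prop where
  smooth : ContDiff ℝ ((⊤ : ℕ∞) : WithTop ℕ∞) φ
  supp : tsupport φ ⊆ closedBall 0 1

namespace IsTest

variable {φ : Euc n → ℝ}

theorem continuous (h : IsTest φ) : Continuous φ := h.smooth.continuous

theorem differentiable (h : IsTest φ) : Differentiable ℝ φ := h.smooth.differentiable (by simp)

theorem contDiff_two (h : IsTest φ) : ContDiff ℝ 2 φ :=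
  h.smooth.of_le (WithTop.coe_le_coe.2 (le_top : (2 : ℕ∞) ≤ ⊤))

theorem hasCompactSupport (h : IsTest φ) : HasCompactSupport φ :=
  (isCompact_closedBall (0 : Euc n) 1).of_isClosed_subset (isClosed_tsupport _) h.supp

theorem integrable (h : IsTest φ) : Integrable φ :=
  h.continuous.integrable_of_hasCompactSupport h.hasCompactSupport

theorem pd (h : IsTest φ) (i : Fin n) : IsTest (pd i φ) :=
  ⟨contDiff_pd h.smooth (by simp) i, (tsupport_pd_subset φ i).trans h.supp⟩

theorem eq_zero (h : IsTest φ) {z : Euc n} (hz : z ∉ closedBall 0 1) : φ z = 0 :=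
  image_eq_zero_of_notMem_tsupport fun hz' => hz (h.supp hz')

theorem coord_mul (h : IsTest φ) (k : Fin n) : IsTest (fun z => z k * φ z) where
  smooth := ContDiff.mul (EuclideanSpace.proj k : Euc n →L[ℝ] ℝ).contDiff h.smooth
  supp := (tsupport_mul_subset_right (f := fun z : Euc n => z k) (g := φ)).trans h.supp

end IsTest

/-- The average `∫ w(x - s z) φ(z) dz`. -/
def scaledAvg (w φ : Euc n → ℝ) (x : Euc n) (s : ℝ) : ℝ := ∫ z, w (x - s • z) * φ z

theorem integrable_scaledAvg {w φ : Euc n → ℝ} (hw : Continuous w) (hφ : IsTest φ) (x : Euc n)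
    (s : ℝ) : Integrable fun z => w (x - s • z) * φ z :=
  ((hw.comp (by fun_prop)).mul hφ.continuous).integrable_of_hasCompactSupport
    hφ.hasCompactSupport.mul_left

theorem continuous_scaledAvg {w φ : Euc n → ℝ} (hw : Continuous w) (hφ : IsTest φ) (x : Euc n)
    (hwc : HasCompactSupport w) : Continuous (scaledAvg w φ x) := by
  obtain ⟨K, hK⟩ := hwc.exists_bound_of_continuous hw
  refine continuous_of_dominated (bound := fun z => K * |φ z|)
    (fun s => (integrable_scaledAvg hw hφ x s).aestronglyMeasurable) (fun s => ?_)
    (hφ.integrable.abs.const_mul K) ?_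
  · filter_upwards with z
    rw [norm_mul]
    exact mul_le_mul_of_nonneg_right (hK _) (norm_nonneg _)
  · filter_upwards with z
    exact (hw.comp (by fun_prop)).mul continuous_const

theorem abs_scaledAvg_le {w φ : Euc n → ℝ} (hφ : IsTest φ) (x : Euc n)
    (s : ℝ) {M : ℝ} (hM : ∀ z ∈ closedBall (0 : Euc n) 1, |w (x - s • z)| ≤ M) :
    |scaledAvg w φ x s| ≤ M * ∫ z, |φ z| := by
  rw [← integral_const_mul M fun z => |φ z|, ← Real.norm_eq_abs, scaledAvg]
  refine norm_integral_le_of_norm_le (hφ.integrable.abs.const_mul M) ?_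
  filter_upwards with z
  rw [norm_mul]
  by_cases hz : z ∈ closedBall (0 : Euc n) 1
  · exact mul_le_mul_of_nonneg_right (hM z hz) (norm_nonneg _)
  · simp [hφ.eq_zero hz]

theorem scaledAvg_sub_eq {w φ : Euc n → ℝ} (hw : Continuous w) (hφ : IsTest φ) (x y : Euc n)
    (s : ℝ) : scaledAvg w φ x s - scaledAvg w φ y s
      = scaledAvg (fun z => w (z + x) - w (z + y)) φ 0 s := by
  unfold scaledAvg
  rw [← integral_sub (integrable_scaledAvg hw hφ x s) (integrable_scaledAvg hw hφ y s)]
  refine integral_congr_ae ?_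
  filter_upwards with z
  rw [← sub_mul]
  congr 4 <;> abel

theorem integral_pd_eq_zero {φ : Euc n → ℝ} (hφ : IsTest φ) (i : Fin n) : ∫ z, pd i φ z = 0 := by
  have h := integral_mul_fderiv_eq_neg_fderiv_mul_of_integrable (μ := (volume : Measure (Euc n)))
    (f := fun _ => (1 : ℝ)) (g := φ) (v := EuclideanSpace.single i 1)
    (by simp) (by simp only [one_mul]; exact (hφ.pd i).integrable) (by simpa using hφ.integrable)
    (fun _ _ => by fun_prop) (fun _ _ => hφ.differentiable _)
  simpa [pd] using h

theorem scaledAvg_sub_const {w φ : Euc n → ℝ} (hw : Continuous w) (hφ : IsTest φ)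
    (h0 : ∫ z, φ z = 0) (x : Euc n) (s c : ℝ) :
    scaledAvg w φ x s = scaledAvg (fun y => w y - c) φ x s := by
  unfold scaledAvg
  simp only [sub_mul]
  rw [integral_sub (integrable_scaledAvg hw hφ x s) (hφ.integrable.const_mul c),
    integral_const_mul, h0]
  simp

/-- Integration by parts. -/
theorem scaledAvg_pd {w φ : Euc n → ℝ} (hw : ContDiff ℝ 1 w) (hφ : IsTest φ) (i : Fin n)
    (x : Euc n) (s : ℝ) : scaledAvg w (pd i φ) x s = s * scaledAvg (pd i w) φ x s := by
  have hder : ∀ z, fderiv ℝ (fun z => w (x - s • z)) z (EuclideanSpace.single i 1)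
      = -(s * pd i w (x - s • z)) := by
    intro z
    have h1 : HasFDerivAt (fun z : Euc n => x - s • z)
        (-(s • ContinuousLinearMap.id ℝ (Euc n))) z := by
      simpa using ((hasFDerivAt_id z).const_smul s).const_sub x
    have h2 := ((hw.differentiable (by norm_num)) (x - s • z)).hasFDerivAt.comp z h1
    have h3 : fderiv ℝ (fun z => w (x - s • z)) z = _ := h2.fderiv
    rw [h3]
    simp [pd]
  have hpd : Continuous (pd i w) := (contDiff_pd (m := 0) hw (by norm_num) i).continuous
  have h := integral_mul_fderiv_eq_neg_fderiv_mul_of_integrable (μ := (volume : Measure (Euc n)))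
    (f := fun z => w (x - s • z)) (g := φ) (v := EuclideanSpace.single i 1)
    (by
      simp only [hder, neg_mul, mul_assoc]
      exact ((integrable_scaledAvg hpd hφ x s).const_mul s).neg)
    (integrable_scaledAvg hw.continuous (hφ.pd i) x s)
    (integrable_scaledAvg hw.continuous hφ x s)
    (fun z _ => ((hw.differentiable (by norm_num)).comp (by fun_prop)) z)
    (fun _ _ => hφ.differentiable _)
  simp only [hder, neg_mul, mul_assoc] at h
  rw [integral_neg, neg_neg, integral_const_mul] at h
  exact h

/-- Differentiation in the scale. -/
theorem hasDerivAt_scaledAvg {w φ : Euc n → ℝ} (hw : ContDiff ℝ 1 w) (hwc : HasCompactSupport w)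
    (hφ : IsTest φ) (x : Euc n) (s : ℝ) :
    HasDerivAt (scaledAvg w φ x)
      (-∑ k, scaledAvg (pd k w) (fun z => z k * φ z) x s) s := by
  have hdw : Continuous (fderiv ℝ w) := hw.continuous_fderiv (by norm_num)
  obtain ⟨K, hK⟩ := (hwc.fderiv (𝕜 := ℝ)).exists_bound_of_continuous hdw
  have hK0 : 0 ≤ K := (norm_nonneg _).trans (hK 0)
  have key := hasDerivAt_integral_of_dominated_loc_of_deriv_le
    (μ := (volume : Measure (Euc n)))
    (F := fun s z => w (x - s • z) * φ z)
    (F' := fun s z => fderiv ℝ w (x - s • z) (-z) * φ z)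
    (x₀ := s) (s := univ) (bound := fun z => K * |φ z|) Filter.univ_mem
    (Filter.Eventually.of_forall fun s =>
      (integrable_scaledAvg hw.continuous hφ x s).aestronglyMeasurable)
    (integrable_scaledAvg hw.continuous hφ x s)
    (by
      refine Continuous.aestronglyMeasurable (Continuous.mul ?_ hφ.continuous)
      exact (hdw.comp (by fun_prop)).clm_apply continuous_neg)
    (by
      filter_upwards with z t _
      rw [norm_mul]
      by_cases hz : z ∈ closedBall (0 : Euc n) 1
      · refine mul_le_mul_of_nonneg_right ?_ (norm_nonneg _)
        refine ((fderiv ℝ w (x - t • z)).le_opNorm _).trans ?_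
        rw [norm_neg]
        have : ‖z‖ ≤ 1 := by simpa using hz
        exact (mul_le_mul (hK _) this (norm_nonneg _) hK0).trans (by simp)
      · simp [hφ.eq_zero hz])
    (hφ.integrable.abs.const_mul K)
    (by
      filter_upwards with z t _
      refine HasDerivAt.mul_const ?_ _
      have h1 : HasDerivAt (fun t : ℝ => x - t • z) (-z) t := by
        simpa using ((hasDerivAt_id t).smul_const z).const_sub x
      exact ((hw.differentiable (by norm_num)) (x - t • z)).hasFDerivAt.comp_hasDerivAt t h1)
  have h_int : ∀ k ∈ Finset.univ, Integrable
      (fun z : Euc n => pd k w (x - s • z) * (z k * φ z)) := fun k _ =>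
    integrable_scaledAvg (contDiff_pd (m := 0) hw (by norm_num) k).continuous (hφ.coord_mul k) x s
  have heq : ∫ z, fderiv ℝ w (x - s • z) (-z) * φ z
      = -∑ k, scaledAvg (pd k w) (fun z => z k * φ z) x s := by
    unfold scaledAvg
    rw [← integral_finsetSum _ h_int, ← integral_neg]
    refine integral_congr_ae ?_
    filter_upwards with z
    rw [map_neg, fderiv_apply_eq_sum_pd, neg_mul, Finset.sum_mul]
    congr 1
    exact Finset.sum_congr rfl fun k _ => by ring
  rw [← heq]
  exact key.2

end ScaledAverages

/-! ### A radial mollifier together with a potential for its scale derivative -/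

section Mollifier

variable {n : ℕ}

/-- A mollifier `η` and a test function `P` with `∇P(z) = 2 η(z) z`. -/
structure IsMollifierPair (η P : Euc n → ℝ) : Prop where
  test_left : IsTest η
  test_right : IsTest P
  pd_right : ∀ k z, pd k P z = 2 * (z k * η z)
  integral_eq_one : ∫ z, η z = 1

theorem isTest_comp_norm_sq {h : ℝ → ℝ} (hh : ContDiff ℝ ((⊤ : ℕ∞) : WithTop ℕ∞) h)
    (h0 : ∀ t, 1 ≤ t → h t = 0) : IsTest fun z : Euc n => h (‖z‖ ^ 2) where
  smooth := hh.comp (contDiff_norm_sq ℝ)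
  supp := by
    refine closure_minimal (fun z hz => ?_) isClosed_closedBall
    by_contra hz'
    refine hz (h0 _ ?_)
    have : 1 < ‖z‖ := by simpa using hz'
    nlinarith

theorem exists_isMollifierPair (n : ℕ) : ∃ η P : Euc n → ℝ, IsMollifierPair η P := by
  set h : ℝ → ℝ := fun t => expNegInvGlue (1 - t) with hh
  have hsm : ContDiff ℝ ((⊤ : ℕ∞) : WithTop ℕ∞) h :=
    expNegInvGlue.contDiff.comp (contDiff_const.sub contDiff_id)
  have h0 : ∀ t, 1 ≤ t → h t = 0 := fun t ht => expNegInvGlue.zero_of_nonpos (by linarith)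
  set H : ℝ → ℝ := fun t => ∫ τ in (1 : ℝ)..t, h τ with hH
  have hder : ∀ t, HasDerivAt H (h t) t := fun t =>
    intervalIntegral.integral_hasDerivAt_right (hsm.continuous.intervalIntegrable _ _)
      (hsm.continuous.stronglyMeasurableAtFilter _ _) hsm.continuous.continuousAt
  have hHsm : ContDiff ℝ ((⊤ : ℕ∞) : WithTop ℕ∞) H := by
    rw [contDiff_infty_iff_deriv]
    refine ⟨fun t => (hder t).differentiableAt, ?_⟩
    rwa [show deriv H = h from funext fun t => (hder t).deriv]
  have hH0 : ∀ t, 1 ≤ t → H t = 0 := by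
    intro t ht
    refine (intervalIntegral.integral_congr (g := fun _ => (0 : ℝ)) fun τ hτ => ?_).trans (by simp)
    rw [uIcc_of_le ht] at hτ
    exact h0 τ hτ.1
  have hη := isTest_comp_norm_sq (n := n) hsm h0
  have hP := isTest_comp_norm_sq (n := n) hHsm hH0
  have hpos : 0 < ∫ z : Euc n, h (‖z‖ ^ 2) := by
    refine hη.continuous.integral_pos_of_hasCompactSupport_nonneg_nonzero hη.hasCompactSupport
      (fun z => expNegInvGlue.nonneg _) (x := 0) ?_
    simp [hh]
  set c := ∫ z : Euc n, h (‖z‖ ^ 2) with hc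
  refine ⟨fun z => c⁻¹ * h (‖z‖ ^ 2), fun z => c⁻¹ * H (‖z‖ ^ 2), ?_, ?_, ?_, ?_⟩
  · exact ⟨contDiff_const.mul hη.smooth,
      (tsupport_mul_subset_right (f := fun _ : Euc n => c⁻¹)).trans hη.supp⟩
  · exact ⟨contDiff_const.mul hP.smooth,
      (tsupport_mul_subset_right (f := fun _ : Euc n => c⁻¹)).trans hP.supp⟩
  · intro k z
    have h1 : HasFDerivAt (fun z : Euc n => ‖z‖ ^ 2) (2 • (innerSL ℝ z)) z :=
      (hasStrictFDerivAt_norm_sq z).hasFDerivAt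
    have h2 := ((hder (‖z‖ ^ 2)).comp_hasFDerivAt z h1).const_mul c⁻¹
    have h3 : fderiv ℝ (fun z : Euc n => c⁻¹ * H (‖z‖ ^ 2)) z = _ := h2.fderiv
    unfold pd
    rw [h3]
    simp [EuclideanSpace.inner_single_right]
    ring
  · rw [integral_const_mul, ← hc, inv_mul_cancel₀ hpos.ne']

theorem scaledAvg_zero_scale {w η P : Euc n → ℝ} (h : IsMollifierPair η P) (x : Euc n) :
    scaledAvg w η x 0 = w x := by
  simp [scaledAvg, integral_const_mul, h.integral_eq_one]

/-- The Laplacian, as the sum of the pure second partial derivatives. -/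
def lap (U : Euc n → ℝ) : Euc n → ℝ := fun x => ∑ k, pd k (pd k U) x

theorem continuous_pd_pd {U : Euc n → ℝ} (hU : ContDiff ℝ 2 U) (i j : Fin n) :
    Continuous (pd i (pd j U)) :=
  (contDiff_pd (m := 0) (contDiff_pd (m := 1) hU (by norm_num) j) (by norm_num) i).continuous

theorem continuous_lap {U : Euc n → ℝ} (hU : ContDiff ℝ 2 U) : Continuous (lap U) :=
  continuous_finsetSum _ fun k _ => continuous_pd_pd hU k k

theorem sum_scaledAvg_pd_pd {U φ : Euc n → ℝ} (hU : ContDiff ℝ 2 U) (hφ : IsTest φ) (x : Euc n)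
    (s : ℝ) : ∑ k, scaledAvg (pd k (pd k U)) φ x s = scaledAvg (lap U) φ x s := by
  unfold scaledAvg lap
  rw [← integral_finsetSum _ fun k _ => integrable_scaledAvg (continuous_pd_pd hU k k) hφ x s]
  simp only [Finset.sum_mul]

theorem scaledAvg_pd_pd_swap {U φ : Euc n → ℝ} (hU : ContDiff ℝ 2 U) (hφ : IsTest φ) (x : Euc n)
    {s : ℝ} (hs : s ≠ 0) (i k : Fin n) :
    scaledAvg (pd k (pd i U)) (pd k φ) x s = scaledAvg (pd k (pd k U)) (pd i φ) x s := by
  have hk : ContDiff ℝ 1 (pd k U) := contDiff_pd hU (by norm_num) k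
  have h1 := scaledAvg_pd hk (hφ.pd k) i x s
  have h2 := scaledAvg_pd hk (hφ.pd i) k x s
  rw [pd_comm hφ.contDiff_two k i, h1, pd_comm hU i k] at h2
  exact mul_left_cancel₀ hs h2

theorem hasDerivAt_scaledAvg_pd {U η P : Euc n → ℝ} (hU : ContDiff ℝ 2 U)
    (hUc : HasCompactSupport U) (h : IsMollifierPair η P) (x : Euc n) {s : ℝ} (hs : s ≠ 0)
    (i : Fin n) :
    HasDerivAt (scaledAvg (pd i U) η x) (-(1 / 2) * scaledAvg (lap U) (pd i P) x s) s := by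
  have hd := hasDerivAt_scaledAvg (contDiff_pd (m := 1) hU (by norm_num) i)
    (hasCompactSupport_pd hUc i) h.test_left x s
  convert hd using 1
  rw [← sum_scaledAvg_pd_pd hU (h.test_right.pd i), Finset.mul_sum, ← Finset.sum_neg_distrib]
  refine Finset.sum_congr rfl fun k _ => ?_
  rw [← scaledAvg_pd_pd_swap hU h.test_right x hs i k]
  unfold scaledAvg
  rw [← integral_const_mul, ← integral_neg]
  refine integral_congr_ae (Filter.Eventually.of_forall fun z => ?_)
  simp only [h.pd_right]
  ring

theorem hasDerivAt_scaledAvg_pd_pd {U η P : Euc n → ℝ} (hU : ContDiff ℝ 2 U)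
    (hUc : HasCompactSupport U) (h : IsMollifierPair η P) (x : Euc n) {s : ℝ} (hs : 0 < s)
    (i j : Fin n) :
    HasDerivAt (scaledAvg (pd j (pd i U)) η x)
      (-(1 / 2) * (s⁻¹ * scaledAvg (lap U) (pd i (pd j P)) x s)) s := by
  have hi : ContDiff ℝ 1 (pd i U) := contDiff_pd (m := 1) hU (by norm_num) i
  have hd := (hasDerivAt_inv hs.ne').mul (hasDerivAt_scaledAvg hi (hasCompactSupport_pd hUc i)
    (h.test_left.pd j) x s)
  have hev : scaledAvg (pd j (pd i U)) η x
      =ᶠ[nhds s] fun t => t⁻¹ * scaledAvg (pd i U) (pd j η) x t := by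
    filter_upwards [lt_mem_nhds hs] with t ht
    rw [scaledAvg_pd hi h.test_left, inv_mul_cancel_left₀ ht.ne']
  refine HasDerivAt.congr_of_eventuallyEq (HasDerivAt.congr_deriv hd ?_) hev
  have hsum : ∑ k, scaledAvg (pd k (pd i U)) (fun z => z k * pd j η z) x s
      = 1 / 2 * scaledAvg (lap U) (pd i (pd j P)) x s - scaledAvg (pd j (pd i U)) η x s := by
    have hpt : ∀ k (z : Euc n), z k * pd j η z
        = 1 / 2 * pd k (pd j P) z - (if j = k then η z else 0) := by
      intro k z
      rw [pd_comm h.test_right.contDiff_two k j,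
        show pd k P = fun z => 2 * (z k * η z) from funext fun z => h.pd_right k z,
        pd_mul (by fun_prop) ((h.test_left.coord_mul k).differentiable z),
        pd_mul (f := fun z : Euc n => z k) (by fun_prop) (h.test_left.differentiable z), pd_coord]
      have : pd j (fun _ : Euc n => (2 : ℝ)) z = 0 := by simp [pd]
      rw [this]
      split_ifs <;> ring
    have hterm : ∀ k, scaledAvg (pd k (pd i U)) (fun z => z k * pd j η z) x s
        = 1 / 2 * scaledAvg (pd k (pd k U)) (pd i (pd j P)) x s
          - (if j = k then scaledAvg (pd k (pd i U)) η x s else 0) := by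
      intro k
      rw [← scaledAvg_pd_pd_swap hU (h.test_right.pd j) x hs.ne' i k]
      have hc := continuous_pd_pd hU k i
      unfold scaledAvg
      simp only [hpt]
      split_ifs with hjk
      · rw [← integral_const_mul, ← integral_sub
          ((integrable_scaledAvg hc ((h.test_right.pd j).pd k) x s).const_mul _)
          (integrable_scaledAvg hc h.test_left x s)]
        exact integral_congr_ae (Filter.Eventually.of_forall fun z => by ring)
      · rw [← integral_const_mul, sub_zero]
        exact integral_congr_ae (Filter.Eventually.of_forall fun z => by ring)
    rw [Finset.sum_congr rfl fun k _ => hterm k, Finset.sum_sub_distrib, ← Finset.mul_sum,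
      sum_scaledAvg_pd_pd hU ((h.test_right.pd j).pd i)]
    simp
  rw [hsum, scaledAvg_pd hi h.test_left]
  field_simp
  ring

theorem abs_sub_le_of_abs_deriv_le {g g' B B' : ℝ → ℝ} {R : ℝ} (hR : 0 ≤ R)
    (hg : ContinuousOn g (Icc 0 R)) (hB : ContinuousOn B (Icc 0 R))
    (hg' : ∀ s ∈ Ioo 0 R, HasDerivAt g (g' s) s) (hB' : ∀ s ∈ Ioo 0 R, HasDerivAt B (B' s) s)
    (hle : ∀ s ∈ Ioo 0 R, |g' s| ≤ B' s) : |g R - g 0| ≤ B R - B 0 := by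
  have h1 : MonotoneOn (fun s => B s - g s) (Icc 0 R) := by
    refine monotoneOn_of_deriv_nonneg (convex_Icc 0 R) (hB.sub hg) ?_ ?_ <;> rw [interior_Icc]
    · exact fun s hs => ((hB' s hs).sub (hg' s hs)).differentiableAt.differentiableWithinAt
    · intro s hs
      rw [((hB' s hs).fun_sub (hg' s hs)).deriv]
      linarith [le_abs_self (g' s), hle s hs]
  have h2 : MonotoneOn (fun s => B s + g s) (Icc 0 R) := by
    refine monotoneOn_of_deriv_nonneg (convex_Icc 0 R) (hB.add hg) ?_ ?_ <;> rw [interior_Icc]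
    · exact fun s hs => ((hB' s hs).add (hg' s hs)).differentiableAt.differentiableWithinAt
    · intro s hs
      rw [((hB' s hs).fun_add (hg' s hs)).deriv]
      linarith [neg_abs_le (g' s), hle s hs]
  have h1' := h1 (left_mem_Icc.2 hR) (right_mem_Icc.2 hR) hR
  have h2' := h2 (left_mem_Icc.2 hR) (right_mem_Icc.2 hR) hR
  simp only at h1' h2'
  rw [abs_le]
  constructor <;> linarith

end Mollifier

/-! ### Estimates for the Poisson equation -/

section Poisson

variable {n : ℕ}

theorem norm_smul_le_of_mem_closedBall {s R : ℝ} (hs : 0 ≤ s) (hsR : s ≤ R) {z : Euc n}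
    (hz : z ∈ closedBall (0 : Euc n) 1) : ‖s • z‖ ≤ s ∧ ‖s • z‖ ≤ R := by
  have h1 : ‖z‖ ≤ 1 := by simpa using hz
  have h2 : ‖s • z‖ ≤ s := by
    rw [norm_smul, Real.norm_of_nonneg hs]
    exact mul_le_of_le_one_right hs h1
  exact ⟨h2, h2.trans hsR⟩

theorem sub_smul_mem_closedBall {s R : ℝ} (hs : 0 ≤ s) (hsR : s ≤ R) (x : Euc n) {z : Euc n}
    (hz : z ∈ closedBall (0 : Euc n) 1) : x - s • z ∈ closedBall x R := by
  simpa [mem_closedBall, dist_eq_norm] using (norm_smul_le_of_mem_closedBall hs hsR hz).2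

theorem abs_pd_le_of_lap_le {U η P : Euc n → ℝ} (hU : ContDiff ℝ 2 U)
    (hUc : HasCompactSupport U) (h : IsMollifierPair η P) (x : Euc n) {R M G : ℝ} (hR : 0 < R)
    (hM : ∀ y ∈ closedBall x R, |U y| ≤ M) (hG : ∀ y ∈ closedBall x R, |lap U y| ≤ G)
    (i : Fin n) :
    |pd i U x| ≤ M / R * (∫ z, |pd i η z|) + R * G * ∫ z, |pd i P z| := by
  have hi : ContDiff ℝ 1 (pd i U) := contDiff_pd (m := 1) hU (by norm_num) i
  set N := ∫ z, |pd i P z| with hN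
  have hN0 : 0 ≤ N := integral_nonneg fun _ => abs_nonneg _
  have hG0 : 0 ≤ G := (abs_nonneg _).trans (hG x (mem_closedBall_self hR.le))
  have h1 := abs_sub_le_of_abs_deriv_le (g := scaledAvg (pd i U) η x) (B := fun s => s * (G * N))
    (g' := fun s => -(1 / 2) * scaledAvg (lap U) (pd i P) x s) (B' := fun _ => 1 * (G * N)) hR.le
    (continuous_scaledAvg hi.continuous h.test_left x (hasCompactSupport_pd hUc i)).continuousOn
    (by fun_prop) (fun s hs => hasDerivAt_scaledAvg_pd hU hUc h x hs.1.ne' i)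
    (fun s _ => (hasDerivAt_id s).mul_const _)
    (fun s hs => by
      have := abs_scaledAvg_le (h.test_right.pd i) x s
        fun z hz => hG _ (sub_smul_mem_closedBall hs.1.le hs.2.le x hz)
      rw [abs_mul, abs_neg, abs_of_pos (by norm_num : (0 : ℝ) < 1 / 2)]
      have h0 := mul_nonneg hG0 hN0
      linarith)
  rw [scaledAvg_zero_scale h] at h1
  have h2 := abs_scaledAvg_le (h.test_left.pd i) x R
    fun z hz => hM _ (sub_smul_mem_closedBall hR.le le_rfl x hz)
  rw [scaledAvg_pd (hU.of_le (by norm_num)) h.test_left, abs_mul, abs_of_pos hR] at h2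
  have h3 : |scaledAvg (pd i U) η x R| ≤ M / R * ∫ z, |pd i η z| := by
    rw [div_mul_eq_mul_div, le_div_iff₀ hR]
    linarith
  have h4 := abs_sub_abs_le_abs_sub (pd i U x) (scaledAvg (pd i U) η x R)
  rw [abs_sub_comm] at h4
  simp only [zero_mul, sub_zero] at h1
  nlinarith

theorem abs_scaledAvg_pd_pd_le {U η P : Euc n → ℝ} (hU : ContDiff ℝ 2 U)
    (h : IsMollifierPair η P) (x y : Euc n) {R K : ℝ} (hR : 0 < R)
    (hK : ∀ z ∈ closedBall (0 : Euc n) 1, |U (x - R • z) - U (y - R • z)| ≤ K)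
    (i j : Fin n) :
    |scaledAvg (pd j (pd i U)) η x R - scaledAvg (pd j (pd i U)) η y R|
      ≤ K / R ^ 2 * ∫ z, |pd i (pd j η) z| := by
  have hi : ContDiff ℝ 1 (pd i U) := contDiff_pd (m := 1) hU (by norm_num) i
  have h0 : ∀ x, scaledAvg U (pd i (pd j η)) x R = R ^ 2 * scaledAvg (pd j (pd i U)) η x R := by
    intro x
    rw [scaledAvg_pd (hU.of_le (by norm_num)) (h.test_left.pd j), scaledAvg_pd hi h.test_left]
    ring
  have h2 := abs_scaledAvg_le (w := fun z => U (z + x) - U (z + y)) (M := K)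
    ((h.test_left.pd j).pd i) 0 R
    (fun z hz => by simpa [sub_eq_add_neg, add_comm] using hK z hz)
  rw [← scaledAvg_sub_eq hU.continuous ((h.test_left.pd j).pd i), h0, h0, ← mul_sub, abs_mul,
    abs_of_pos (by positivity : (0 : ℝ) < R ^ 2)] at h2
  rw [div_mul_eq_mul_div, le_div_iff₀ (by positivity)]
  linarith

theorem abs_scaledAvg_lap_le {U φ : Euc n → ℝ} (hU : ContDiff ℝ 2 U) (hφ : IsTest φ)
    (h0 : ∫ z, φ z = 0) (x : Euc n) {s L : ℝ} (hs : 0 < s)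
    (hL0 : 0 ≤ L) (hL : ∀ y ∈ closedBall x s, |lap U y - lap U x| ≤ L * dist y x) :
    |scaledAvg (lap U) φ x s| ≤ L * s * ∫ z, |φ z| := by
  rw [scaledAvg_sub_const (continuous_lap hU) hφ h0 x s (lap U x)]
  refine abs_scaledAvg_le hφ x s fun z hz => ?_
  refine (hL _ (sub_smul_mem_closedBall hs.le le_rfl x hz)).trans ?_
  refine mul_le_mul_of_nonneg_left ?_ hL0
  exact sub_smul_mem_closedBall hs.le le_rfl x hz

theorem abs_pd_pd_le_of_lap_lipschitz {U η P : Euc n → ℝ} (hU : ContDiff ℝ 2 U)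
    (hUc : HasCompactSupport U) (h : IsMollifierPair η P) (x : Euc n) {R M L : ℝ} (hR : 0 < R)
    (hM : ∀ y ∈ closedBall x R, |U y| ≤ M) (hL0 : 0 ≤ L)
    (hL : ∀ y ∈ closedBall x R, |lap U y - lap U x| ≤ L * dist y x) (i j : Fin n) :
    |pd j (pd i U) x| ≤ M / R ^ 2 * (∫ z, |pd i (pd j η) z|)
      + R * L * ∫ z, |pd i (pd j P) z| := by
  have hi : ContDiff ℝ 1 (pd i U) := contDiff_pd (m := 1) hU (by norm_num) i
  set N := ∫ z, |pd i (pd j P) z| with hN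
  have hN0 : 0 ≤ N := integral_nonneg fun _ => abs_nonneg _
  have h1 := abs_sub_le_of_abs_deriv_le (g := scaledAvg (pd j (pd i U)) η x)
    (B := fun s => s * (L * N))
    (g' := fun s => -(1 / 2) * (s⁻¹ * scaledAvg (lap U) (pd i (pd j P)) x s))
    (B' := fun _ => 1 * (L * N)) hR.le
    (continuous_scaledAvg (continuous_pd_pd hU j i) h.test_left x
      (hasCompactSupport_pd (hasCompactSupport_pd hUc i) j)).continuousOn
    (by fun_prop) (fun s hs => hasDerivAt_scaledAvg_pd_pd hU hUc h x hs.1 i j)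
    (fun s _ => (hasDerivAt_id s).mul_const _)
    (fun s hs => by
      have h3 := abs_scaledAvg_lap_le hU ((h.test_right.pd j).pd i)
        (integral_pd_eq_zero (h.test_right.pd j) i) x hs.1 hL0
        fun y hy => hL y (closedBall_subset_closedBall hs.2.le hy)
      rw [abs_mul, abs_mul, abs_neg, abs_of_pos (by norm_num : (0 : ℝ) < 1 / 2),
        abs_of_pos (inv_pos.2 hs.1)]
      have h4 : s⁻¹ * |scaledAvg (lap U) (pd i (pd j P)) x s| ≤ L * N := by
        rw [inv_mul_le_iff₀ hs.1]
        linarith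
      have h0 := mul_nonneg hL0 hN0
      linarith)
  rw [scaledAvg_zero_scale h] at h1
  have h2 : |scaledAvg (pd j (pd i U)) η x R| ≤ M / R ^ 2 * ∫ z, |pd i (pd j η) z| := by
    have h5 := abs_scaledAvg_le ((h.test_left.pd j).pd i) x R
      fun z hz => hM _ (sub_smul_mem_closedBall hR.le le_rfl x hz)
    rw [scaledAvg_pd (hU.of_le (by norm_num)) (h.test_left.pd j), scaledAvg_pd hi h.test_left,
      ← mul_assoc, abs_mul, abs_of_pos (mul_pos hR hR)] at h5
    rw [div_mul_eq_mul_div, le_div_iff₀ (by positivity)]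
    linarith
  have h4 := abs_sub_abs_le_abs_sub (pd j (pd i U) x) (scaledAvg (pd j (pd i U)) η x R)
  rw [abs_sub_comm] at h4
  simp only [zero_mul, sub_zero] at h1
  linarith

theorem le_rpow_mul_rpow_of_le {q s t α : ℝ} (hs : 0 < s) (ht : 0 ≤ t) (hα0 : 0 < α)
    (hα1 : α < 1) (hqs : q ≤ s) (hqt : q ≤ t) : q ≤ s ^ (1 - α) * t ^ α := by
  rcases le_total t s with hts | hts
  · rcases ht.eq_or_lt with rfl | ht'
    · rw [Real.zero_rpow hα0.ne']
      simpa using hqt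
    calc q ≤ t := hqt
      _ = t ^ (1 - α) * t ^ α := by rw [← Real.rpow_add ht']; simp
      _ ≤ s ^ (1 - α) * t ^ α := by gcongr
  · calc q ≤ s := hqs
      _ = s ^ (1 - α) * s ^ α := by rw [← Real.rpow_add hs]; simp
      _ ≤ s ^ (1 - α) * t ^ α := by gcongr

theorem abs_pd_pd_sub_le_of_lap_lipschitz {U η P : Euc n → ℝ} (hU : ContDiff ℝ 2 U)
    (hUc : HasCompactSupport U) (h : IsMollifierPair η P) (x y : Euc n) {R K L α : ℝ}
    (hα0 : 0 < α) (hα1 : α < 1) (hR : 0 < R)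
    (hK : ∀ z ∈ closedBall (0 : Euc n) R, |U (x - z) - U (y - z)| ≤ K) (hL0 : 0 ≤ L)
    (hL : ∀ z ∈ closedBall (0 : Euc n) R, |lap U (x - z) - lap U (y - z)| ≤ L * dist x y)
    (hLx : ∀ z ∈ closedBall x R, |lap U z - lap U x| ≤ L * dist z x)
    (hLy : ∀ z ∈ closedBall y R, |lap U z - lap U y| ≤ L * dist z y) (i j : Fin n) :
    |pd j (pd i U) x - pd j (pd i U) y| ≤ K / R ^ 2 * (∫ z, |pd i (pd j η) z|)
      + L * dist x y ^ α * R ^ (1 - α) / (1 - α) * ∫ z, |pd i (pd j P) z| := by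
  set φ := pd i (pd j P) with hφdef
  have hφ : IsTest φ := (h.test_right.pd j).pd i
  set N := ∫ z, |φ z| with hN
  have hN0 : 0 ≤ N := integral_nonneg fun _ => abs_nonneg _
  have h1α : 0 < 1 - α := by linarith
  have hcont := fun x => (continuous_scaledAvg (continuous_pd_pd hU j i) h.test_left x
      (hasCompactSupport_pd (hasCompactSupport_pd hUc i) j))
  have h1 := abs_sub_le_of_abs_deriv_le
    (g := fun s => scaledAvg (pd j (pd i U)) η x s - scaledAvg (pd j (pd i U)) η y s)
    (B := fun s => L * dist x y ^ α * N / (1 - α) * s ^ (1 - α))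
    (g' := fun s => -(1 / 2) * (s⁻¹ * scaledAvg (lap U) φ x s)
      - -(1 / 2) * (s⁻¹ * scaledAvg (lap U) φ y s))
    (B' := fun s => L * dist x y ^ α * N / (1 - α) * ((1 - α) * s ^ (1 - α - 1))) hR.le
    ((hcont x).sub (hcont y)).continuousOn
    ((continuous_const.mul (Real.continuous_rpow_const h1α.le)).continuousOn)
    (fun s hs => (hasDerivAt_scaledAvg_pd_pd hU hUc h x hs.1 i j).sub
      (hasDerivAt_scaledAvg_pd_pd hU hUc h y hs.1 i j))
    (fun s hs => (Real.hasDerivAt_rpow_const (Or.inl hs.1.ne')).const_mul _)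
    (fun s hs => by
      have h0 : ∫ z, φ z = 0 := integral_pd_eq_zero (h.test_right.pd j) i
      have hx := abs_scaledAvg_lap_le hU hφ h0 x hs.1 hL0
        fun y hy => hLx y (closedBall_subset_closedBall hs.2.le hy)
      have hy := abs_scaledAvg_lap_le hU hφ h0 y hs.1 hL0
        fun y hy => hLy y (closedBall_subset_closedBall hs.2.le hy)
      have hxy := abs_scaledAvg_le (w := fun z => lap U (z + x) - lap U (z + y))
        (M := L * dist x y) hφ 0 s (fun z hz => by
          have hz' : s • z ∈ closedBall (0 : Euc n) R := by
            simpa using (norm_smul_le_of_mem_closedBall hs.1.le hs.2.le hz).2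
          simpa [sub_eq_add_neg, add_comm] using hL _ hz')
      rw [← scaledAvg_sub_eq (continuous_lap hU) hφ] at hxy
      set A := scaledAvg (lap U) φ x s
      set A' := scaledAvg (lap U) φ y s
      have hA : |A - A'| ≤ 2 * (L * N * (s ^ (1 - α) * dist x y ^ α)) := by
        have h3 : |A - A'| ≤ 2 * (L * N * s) := by
          have := abs_sub A A'
          linarith
        rcases le_total s (dist x y) with hle | hle
        · refine h3.trans ?_
          have := le_rpow_mul_rpow_of_le hs.1 dist_nonneg hα0 hα1 le_rfl hle
          gcongr
        · have := le_rpow_mul_rpow_of_le hs.1 (dist_nonneg (x := x) (y := y)) hα0 hα1 hle le_rfl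
          have h4 : L * N * dist x y ≤ L * N * (s ^ (1 - α) * dist x y ^ α) := by gcongr
          have h5 : 0 ≤ L * N * dist x y := by positivity
          linarith
      have h6 : -(1 / 2) * (s⁻¹ * A) - -(1 / 2) * (s⁻¹ * A') = -(1 / 2) * s⁻¹ * (A - A') := by ring
      have h7 : L * dist x y ^ α * N / (1 - α) * ((1 - α) * s ^ (1 - α - 1))
          = 1 / 2 * s⁻¹ * (2 * (L * N * (s ^ (1 - α) * dist x y ^ α))) := by
        rw [Real.rpow_sub_one hs.1.ne']
        field_simp
      rw [h6, h7, abs_mul, abs_mul, abs_neg, abs_of_pos (by norm_num : (0 : ℝ) < 1 / 2),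
        abs_of_pos (inv_pos.2 hs.1)]
      have := inv_pos.2 hs.1
      gcongr)
  simp only [scaledAvg_zero_scale h, Real.zero_rpow h1α.ne', mul_zero, sub_zero] at h1
  have h2 := abs_scaledAvg_pd_pd_le hU h x y hR (fun z hz => hK (R • z) (by
    simpa using (norm_smul_le_of_mem_closedBall hR.le le_rfl hz).2)) i j
  have h4 := abs_sub_abs_le_abs_sub (pd j (pd i U) x - pd j (pd i U) y)
    (scaledAvg (pd j (pd i U)) η x R - scaledAvg (pd j (pd i U)) η y R)
  rw [abs_sub_comm (pd j (pd i U) x - pd j (pd i U) y)] at h4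
  have h5 : L * dist x y ^ α * N / (1 - α) * R ^ (1 - α)
      = L * dist x y ^ α * R ^ (1 - α) / (1 - α) * N := by ring
  linarith

end Poisson

/-! ### Interior estimates for `Δ U = p · ∇U + q U` -/

section LowerOrder

variable {n : ℕ}

/-- The `ℓ¹` norm of the gradient. -/
def gradSum (U : Euc n → ℝ) (x : Euc n) : ℝ := ∑ i, |pd i U x|

/-- The `ℓ¹` norm of the Hessian. -/
def hessSum (U : Euc n → ℝ) (x : Euc n) : ℝ := ∑ i, ∑ j, |pd j (pd i U) x|

theorem gradSum_nonneg (U : Euc n → ℝ) (x : Euc n) : 0 ≤ gradSum U x :=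
  Finset.sum_nonneg fun _ _ => abs_nonneg _

theorem hessSum_nonneg (U : Euc n → ℝ) (x : Euc n) : 0 ≤ hessSum U x :=
  Finset.sum_nonneg fun _ _ => Finset.sum_nonneg fun _ _ => abs_nonneg _

theorem abs_pd_le_gradSum (U : Euc n → ℝ) (x : Euc n) (i : Fin n) : |pd i U x| ≤ gradSum U x :=
  Finset.single_le_sum (f := fun i => |pd i U x|) (fun _ _ => abs_nonneg _) (Finset.mem_univ i)

theorem gradSum_pd_le_hessSum (U : Euc n → ℝ) (x : Euc n) (i : Fin n) :
    gradSum (pd i U) x ≤ hessSum U x :=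
  Finset.single_le_sum (f := fun i => gradSum (pd i U) x)
    (fun _ _ => gradSum_nonneg _ _) (Finset.mem_univ i)

theorem continuous_gradSum {U : Euc n → ℝ} (hU : ContDiff ℝ 2 U) : Continuous (gradSum U) :=
  continuous_finsetSum _ fun i _ => (contDiff_pd (m := 1) hU (by norm_num) i).continuous.abs

theorem continuous_hessSum {U : Euc n → ℝ} (hU : ContDiff ℝ 2 U) : Continuous (hessSum U) :=
  continuous_finsetSum _ fun i _ => continuous_finsetSum _ fun j _ =>
    (continuous_pd_pd hU j i).abs

theorem abs_sub_le_of_gradSum_le {f : Euc n → ℝ} (hf : ContDiff ℝ 1 f) {S : Set (Euc n)}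
    (hS : Convex ℝ S) {D : ℝ} (hD : ∀ x ∈ S, gradSum f x ≤ D) {x y : Euc n} (hx : x ∈ S)
    (hy : y ∈ S) : |f x - f y| ≤ D * dist x y := by
  rw [dist_eq_norm]
  exact hS.norm_image_sub_le_of_norm_fderiv_le
    (fun z _ => (hf.differentiable (by norm_num)) z)
    (fun z hz => (norm_fderiv_le_sum_pd f z).trans (hD z hz)) hy hx

/-- Derivative estimates for the Poisson equation with a constant depending only on `n`. -/
theorem exists_poisson_estimate (n : ℕ) : ∃ N : ℝ, 0 ≤ N ∧
    ∀ U : Euc n → ℝ, ContDiff ℝ 2 U → HasCompactSupport U → ∀ R : ℝ, 0 < R →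
      (∀ x M G, (∀ y ∈ closedBall x R, |U y| ≤ M) → (∀ y ∈ closedBall x R, |lap U y| ≤ G) →
        gradSum U x ≤ N * (M / R + R * G)) ∧
      (∀ x M L, 0 ≤ L → (∀ y ∈ closedBall x R, |U y| ≤ M) →
        (∀ y ∈ closedBall x R, |lap U y - lap U x| ≤ L * dist y x) →
        hessSum U x ≤ N * (M / R ^ 2 + R * L)) ∧
      (∀ x y K L α, 0 < α → α < 1 → 0 ≤ K → 0 ≤ L →
        (∀ z ∈ closedBall (0 : Euc n) R, |U (x - z) - U (y - z)| ≤ K) →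
        (∀ z ∈ closedBall (0 : Euc n) R, |lap U (x - z) - lap U (y - z)| ≤ L * dist x y) →
        (∀ z ∈ closedBall x R, |lap U z - lap U x| ≤ L * dist z x) →
        (∀ z ∈ closedBall y R, |lap U z - lap U y| ≤ L * dist z y) → ∀ i j,
        |pd j (pd i U) x - pd j (pd i U) y|
          ≤ N * (K / R ^ 2 + L * dist x y ^ α * R ^ (1 - α) / (1 - α))) := by
  obtain ⟨η, P, h⟩ := exists_isMollifierPair n
  have h_int : ∀ f : Euc n → ℝ, 0 ≤ ∫ z, |f z| := fun f => integral_nonneg fun _ => abs_nonneg _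
  set a₁ := ∑ i, ∫ z, |pd i η z| with ha₁
  set b₁ := ∑ i, ∫ z, |pd i P z| with hb₁
  set a₂ := ∑ i, ∑ j, ∫ z, |pd i (pd j η) z| with ha₂
  set b₂ := ∑ i, ∑ j, ∫ z, |pd i (pd j P) z| with hb₂
  have ha₁0 : 0 ≤ a₁ := Finset.sum_nonneg fun _ _ => h_int _
  have hb₁0 : 0 ≤ b₁ := Finset.sum_nonneg fun _ _ => h_int _
  have ha₂0 : 0 ≤ a₂ := Finset.sum_nonneg fun _ _ => Finset.sum_nonneg fun _ _ => h_int _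
  have hb₂0 : 0 ≤ b₂ := Finset.sum_nonneg fun _ _ => Finset.sum_nonneg fun _ _ => h_int _
  have hsingle : ∀ (F : Fin n → Fin n → ℝ), (∀ i j, 0 ≤ F i j) → ∀ i j,
      F i j ≤ ∑ i, ∑ j, F i j := fun F hF i j =>
    (Finset.single_le_sum (f := F i) (fun j _ => hF i j) (Finset.mem_univ j)).trans
      (Finset.single_le_sum (f := fun i => ∑ j, F i j)
        (fun i _ => Finset.sum_nonneg fun j _ => hF i j) (Finset.mem_univ i))
  have hcomb : ∀ p q c d : ℝ, 0 ≤ p → 0 ≤ q → c ≤ a₁ + b₁ + a₂ + b₂ → d ≤ a₁ + b₁ + a₂ + b₂ →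
      p * c + q * d ≤ (a₁ + b₁ + a₂ + b₂) * (p + q) := by
    intro p q c d hp hq hc hd
    have := mul_le_mul_of_nonneg_left hc hp
    have := mul_le_mul_of_nonneg_left hd hq
    linarith
  refine ⟨a₁ + b₁ + a₂ + b₂, by positivity, fun U hU hUc R hR => ⟨?_, ?_, ?_⟩⟩
  · intro x M G hM hG
    have hM0 : 0 ≤ M := (abs_nonneg _).trans (hM x (mem_closedBall_self hR.le))
    have hG0 : 0 ≤ G := (abs_nonneg _).trans (hG x (mem_closedBall_self hR.le))
    refine (Finset.sum_le_sum fun i _ => abs_pd_le_of_lap_le hU hUc h x hR hM hG i).trans ?_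
    rw [Finset.sum_add_distrib, ← Finset.mul_sum, ← Finset.mul_sum]
    exact hcomb _ _ _ _ (by positivity) (by positivity) (by linarith) (by linarith)
  · intro x M L hL0 hM hL
    have hM0 : 0 ≤ M := (abs_nonneg _).trans (hM x (mem_closedBall_self hR.le))
    refine (Finset.sum_le_sum fun i _ => Finset.sum_le_sum fun j _ =>
      abs_pd_pd_le_of_lap_lipschitz hU hUc h x hR hM hL0 hL i j).trans ?_
    simp only [Finset.sum_add_distrib, ← Finset.mul_sum]
    exact hcomb _ _ _ _ (by positivity) (by positivity) (by linarith) (by linarith)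
  · intro x y K L α hα0 hα1 hK0 hL0 hK hL hLx hLy i j
    refine (abs_pd_pd_sub_le_of_lap_lipschitz hU hUc h x y hα0 hα1 hR hK hL0 hL hLx hLy i j).trans
      ?_
    have h1 := hsingle (fun i j => ∫ z, |pd i (pd j η) z|) (fun _ _ => h_int _) i j
    have h2 := hsingle (fun i j => ∫ z, |pd i (pd j P) z|) (fun _ _ => h_int _) i j
    simp only [← ha₂, ← hb₂] at h1 h2
    have : 0 < 1 - α := by linarith
    exact hcomb _ _ _ _ (by positivity) (by positivity) (by linarith) (by linarith)

/-- The coefficients `p`, `q` are bounded by `B` and Lipschitz with constant `B`. -/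
structure IsLowerOrder (B : ℝ) (p : Fin n → Euc n → ℝ) (q : Euc n → ℝ) : Prop where
  abs_p : ∀ k x, |p k x| ≤ B
  lip_p : ∀ k x y, |p k x - p k y| ≤ B * dist x y
  abs_q : ∀ x, |q x| ≤ B
  lip_q : ∀ x y, |q x - q y| ≤ B * dist x y

variable {B : ℝ} {p : Fin n → Euc n → ℝ} {q : Euc n → ℝ}

theorem IsLowerOrder.nonneg (h : IsLowerOrder B p q) : 0 ≤ B := (abs_nonneg _).trans (h.abs_q 0)

theorem abs_lap_le (h : IsLowerOrder B p q) {U : Euc n → ℝ} {x : Euc n}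
    (hx : lap U x = ∑ k, p k x * pd k U x + q x * U x) :
    |lap U x| ≤ B * (|U x| + gradSum U x) := by
  rw [hx, mul_add, add_comm (B * |U x|)]
  refine (abs_add_le _ _).trans (add_le_add ?_ ?_)
  · rw [gradSum, Finset.mul_sum]
    refine (Finset.abs_sum_le_sum_abs _ _).trans (Finset.sum_le_sum fun k _ => ?_)
    rw [abs_mul]
    exact mul_le_mul_of_nonneg_right (h.abs_p k x) (abs_nonneg _)
  · rw [abs_mul]
    exact mul_le_mul_of_nonneg_right (h.abs_q x) (abs_nonneg _)

theorem abs_mul_sub_mul_le (a a' b b' : ℝ) :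
    |a * b - a' * b'| ≤ |a - a'| * |b| + |a'| * |b - b'| := by
  rw [← abs_mul, ← abs_mul, show a * b - a' * b' = (a - a') * b + a' * (b - b') by ring]
  exact abs_add_le _ _

theorem abs_lap_sub_le (h : IsLowerOrder B p q) {U : Euc n → ℝ} (hU : ContDiff ℝ 2 U)
    {S : Set (Euc n)} (hS : Convex ℝ S)
    (heq : ∀ x ∈ S, lap U x = ∑ k, p k x * pd k U x + q x * U x) {M D₁ D₂ : ℝ}
    (hM : ∀ x ∈ S, |U x| ≤ M) (hD₁ : ∀ x ∈ S, gradSum U x ≤ D₁) (hD₂ : ∀ x ∈ S, hessSum U x ≤ D₂)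
    {x y : Euc n} (hx : x ∈ S) (hy : y ∈ S) :
    |lap U x - lap U y| ≤ B * (n + 2) * (M + D₁ + D₂) * dist x y := by
  have hB := h.nonneg
  have hd : 0 ≤ dist x y := dist_nonneg
  have hM0 : 0 ≤ M := (abs_nonneg _).trans (hM x hx)
  have hD₁0 : 0 ≤ D₁ := (gradSum_nonneg _ _).trans (hD₁ x hx)
  have hD₂0 : 0 ≤ D₂ := (hessSum_nonneg _ _).trans (hD₂ x hx)
  have hterm : ∀ k, |p k x * pd k U x - p k y * pd k U y|
      ≤ B * dist x y * |pd k U x| + B * (D₂ * dist x y) := by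
    intro k
    refine (abs_mul_sub_mul_le _ _ _ _).trans (add_le_add ?_ ?_)
    · exact mul_le_mul_of_nonneg_right (h.lip_p k x y) (abs_nonneg _)
    · refine mul_le_mul (h.abs_p k y) ?_ (abs_nonneg _) hB
      exact abs_sub_le_of_gradSum_le (contDiff_pd (m := 1) hU (by norm_num) k) hS
        (fun z hz => (gradSum_pd_le_hessSum U z k).trans (hD₂ z hz)) hx hy
  have hsum : |∑ k, p k x * pd k U x - ∑ k, p k y * pd k U y|
      ≤ B * dist x y * D₁ + n * (B * (D₂ * dist x y)) := by
    rw [← Finset.sum_sub_distrib]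
    refine (Finset.abs_sum_le_sum_abs _ _).trans ((Finset.sum_le_sum fun k _ => hterm k).trans ?_)
    rw [Finset.sum_add_distrib, ← Finset.mul_sum]
    simp only [Finset.sum_const, Finset.card_univ, Fintype.card_fin, nsmul_eq_mul]
    have := mul_le_mul_of_nonneg_left (hD₁ x hx) (mul_nonneg hB hd)
    rw [gradSum] at this
    linarith
  have hq : |q x * U x - q y * U y| ≤ B * dist x y * M + B * (D₁ * dist x y) := by
    refine (abs_mul_sub_mul_le _ _ _ _).trans (add_le_add ?_ ?_)
    · exact mul_le_mul (h.lip_q x y) (hM x hx) (abs_nonneg _) (by positivity)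
    · exact mul_le_mul (h.abs_q y)
        (abs_sub_le_of_gradSum_le (hU.of_le (by norm_num)) hS hD₁ hx hy) (abs_nonneg _) hB
  rw [heq x hx, heq y hy, add_sub_add_comm]
  refine (abs_add_le _ _).trans ((add_le_add hsum hq).trans ?_)
  have h1 : 0 ≤ B * dist x y := by positivity
  have h2 : 0 ≤ B * dist x y * (n * (M + D₁) + M + 2 * D₂) := by positivity
  nlinarith

theorem exists_interior_bound (n : ℕ) {B : ℝ} (hB : 0 ≤ B) : ∃ C : ℝ, 0 ≤ C ∧
    ∀ (p : Fin n → Euc n → ℝ) (q : Euc n → ℝ), IsLowerOrder B p q →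
    ∀ U : Euc n → ℝ, ContDiff ℝ 2 U → HasCompactSupport U →
    ∀ (x₀ : Euc n) (r M : ℝ), 0 < r → r ≤ 1 →
      (∀ x ∈ closedBall x₀ r, |U x| ≤ M) →
      (∀ x ∈ closedBall x₀ r, lap U x = ∑ k, p k x * pd k U x + q x * U x) →
      ∀ x ∈ closedBall x₀ (r / 2), gradSum U x ≤ C * M / r ∧ hessSum U x ≤ C * M / r ^ 2 := by
  obtain ⟨N, hN, hest⟩ := exists_poisson_estimate n
  set E := B * (n + 2) with hE
  have hE0 : 0 ≤ E := by positivity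
  have hBE : B ≤ E := by
    rw [hE]
    nlinarith [(Nat.cast_nonneg n : (0 : ℝ) ≤ n)]
  set θ := 1 / (16 * (N * E) + 2) with hθ
  have hden : 0 < 16 * (N * E) + 2 := by positivity
  have hθ0 : 0 < θ := by positivity
  have hθhalf : θ ≤ 1 / 2 := by
    rw [hθ]
    exact one_div_le_one_div_of_le (by norm_num) (by nlinarith [mul_nonneg hN hE0])
  have hθsmall : 8 * θ * (N * E) ≤ 1 / 2 := by
    have : θ * (16 * (N * E) + 2) = 1 := by
      rw [hθ]
      field_simp
    nlinarith
  set C := 2 * (N * (1 / θ + 1 / θ ^ 2 + 2 * θ * E)) with hC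
  have hC0 : 0 ≤ C := by positivity
  refine ⟨4 * C, by positivity, ?_⟩
  intro p q hpq U hU hUc x₀ r M hr hr1 hM heq
  have hM0 : 0 ≤ M := (abs_nonneg _).trans (hM x₀ (mem_closedBall_self hr.le))
  set Q : Euc n → ℝ := fun x =>
    (r - dist x x₀) * gradSum U x + (r - dist x x₀) ^ 2 * hessSum U x with hQ
  have hQc : Continuous Q := by
    have h1 := continuous_gradSum hU
    have h2 := continuous_hessSum hU
    fun_prop
  obtain ⟨x', hx', hmax⟩ := (isCompact_closedBall x₀ r).exists_isMaxOn
    ⟨x₀, mem_closedBall_self hr.le⟩ hQc.continuousOn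
  set A := Q x' with hA
  have hQA : ∀ y ∈ closedBall x₀ r, Q y ≤ A := fun y hy => hmax hy
  have hgradA : ∀ y ∈ closedBall x₀ r, (r - dist y x₀) * gradSum U y ≤ A := by
    intro y hy
    have h1 : 0 ≤ (r - dist y x₀) ^ 2 * hessSum U y :=
      mul_nonneg (sq_nonneg _) (hessSum_nonneg _ _)
    have := hQA y hy
    simp only [hQ] at this
    linarith
  have hhessA : ∀ y ∈ closedBall x₀ r, (r - dist y x₀) ^ 2 * hessSum U y ≤ A := by
    intro y hy
    have h1 : 0 ≤ (r - dist y x₀) * gradSum U y :=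
      mul_nonneg (sub_nonneg.2 hy) (gradSum_nonneg _ _)
    have := hQA y hy
    simp only [hQ] at this
    linarith
  have hA0 : 0 ≤ A := by
    refine le_trans ?_ (hhessA x' hx')
    exact mul_nonneg (sq_nonneg _) (hessSum_nonneg _ _)
  have hAC : A ≤ C * M := by
    set d := r - dist x' x₀ with hd
    have hd0 : 0 ≤ d := sub_nonneg.2 hx'
    rcases hd0.eq_or_lt with hd0' | hdpos
    · have : A = 0 := by
        rw [hA]
        simp only [hQ, ← hd, ← hd0']
        ring
      rw [this]
      positivity
    have hd1 : d ≤ 1 := by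
      have : 0 ≤ dist x' x₀ := dist_nonneg
      linarith
    have hR : 0 < θ * d := by positivity
    have hball : ∀ y ∈ closedBall x' (θ * d), d / 2 ≤ r - dist y x₀ := by
      intro y hy
      have h1 : dist y x' ≤ θ * d := hy
      have h2 := dist_triangle y x' x₀
      have h3 : θ * d ≤ 1 / 2 * d := by gcongr
      linarith
    have hsub : ∀ y ∈ closedBall x' (θ * d), y ∈ closedBall x₀ r := by
      intro y hy
      have := hball y hy
      rw [mem_closedBall]
      linarith
    have hgrad : ∀ y ∈ closedBall x' (θ * d), gradSum U y ≤ 2 * A / d := by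
      intro y hy
      have h1 := mul_le_mul_of_nonneg_right (hball y hy) (gradSum_nonneg U y)
      have h2 := hgradA y (hsub y hy)
      rw [le_div_iff₀ hdpos]
      linarith
    have hhess : ∀ y ∈ closedBall x' (θ * d), hessSum U y ≤ 4 * A / d ^ 2 := by
      intro y hy
      have h0 : (d / 2) ^ 2 ≤ (r - dist y x₀) ^ 2 := by
        have := hball y hy
        gcongr
      have h1 := mul_le_mul_of_nonneg_right h0 (hessSum_nonneg U y)
      have h2 := hhessA y (hsub y hy)
      rw [le_div_iff₀ (by positivity)]
      linarith
    have hxR : x' ∈ closedBall x' (θ * d) := mem_closedBall_self hR.le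
    have e1 := (hest U hU hUc (θ * d) hR).1 x' M (B * (M + 2 * A / d))
      (fun y hy => hM y (hsub y hy))
      (fun y hy => (abs_lap_le hpq (heq y (hsub y hy))).trans
        (mul_le_mul_of_nonneg_left (add_le_add (hM y (hsub y hy)) (hgrad y hy)) hB))
    have e2 := (hest U hU hUc (θ * d) hR).2.1 x' M (E * (M + 2 * A / d + 4 * A / d ^ 2))
      (by positivity) (fun y hy => hM y (hsub y hy))
      (fun y hy => abs_lap_sub_le hpq hU (convex_closedBall _ _) (fun z hz => heq z (hsub z hz))
        (fun z hz => hM z (hsub z hz)) hgrad hhess hy hxR)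
    have f1 : d * gradSum U x' ≤ N * (M / θ + θ * E * (M + 2 * A)) := by
      calc d * gradSum U x' ≤ d * (N * (M / (θ * d) + θ * d * (B * (M + 2 * A / d)))) := by gcongr
        _ = N * (M / θ + θ * B * (d * (d * M) + d * (2 * A))) := by field_simp
        _ ≤ N * (M / θ + θ * E * (1 * (1 * M) + 1 * (2 * A))) := by gcongr
        _ = N * (M / θ + θ * E * (M + 2 * A)) := by ring
    have f2 : d ^ 2 * hessSum U x' ≤ N * (M / θ ^ 2 + θ * E * (M + 6 * A)) := by
      calc d ^ 2 * hessSum U x'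
          ≤ d ^ 2 * (N * (M / (θ * d) ^ 2
            + θ * d * (E * (M + 2 * A / d + 4 * A / d ^ 2)))) := by gcongr
        _ = N * (M / θ ^ 2 + θ * E * (d ^ 3 * M + d ^ 2 * (2 * A) + d * (4 * A))) := by
          field_simp
        _ ≤ N * (M / θ ^ 2 + θ * E * (1 ^ 3 * M + 1 ^ 2 * (2 * A) + 1 * (4 * A))) := by gcongr
        _ = N * (M / θ ^ 2 + θ * E * (M + 6 * A)) := by ring
    have hsum : A ≤ N * (M / θ + θ * E * (M + 2 * A)) + N * (M / θ ^ 2 + θ * E * (M + 6 * A)) :=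
      add_le_add f1 f2
    have hre : N * (M / θ + θ * E * (M + 2 * A)) + N * (M / θ ^ 2 + θ * E * (M + 6 * A))
        = C / 2 * M + 8 * θ * (N * E) * A := by
      rw [hC]
      ring
    rw [hre] at hsum
    have := mul_le_mul_of_nonneg_right hθsmall hA0
    linarith
  intro x hx
  have hxr : x ∈ closedBall x₀ r := closedBall_subset_closedBall (by linarith) hx
  have hdx : r / 2 ≤ r - dist x x₀ := by
    have : dist x x₀ ≤ r / 2 := hx
    linarith
  constructor
  · have h1 := mul_le_mul_of_nonneg_right hdx (gradSum_nonneg U x)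
    have h2 := hgradA x hxr
    have h3 : 0 ≤ C * M := by positivity
    rw [le_div_iff₀ hr]
    linarith
  · have h0 : (r / 2) ^ 2 ≤ (r - dist x x₀) ^ 2 := by gcongr
    have h1 := mul_le_mul_of_nonneg_right h0 (hessSum_nonneg U x)
    have h2 := hhessA x hxr
    rw [le_div_iff₀ (by positivity)]
    linarith

theorem exists_interior_holder (n : ℕ) {B : ℝ} (hB : 0 ≤ B) {α : ℝ} (hα0 : 0 < α) (hα1 : α < 1) :
    ∃ C : ℝ, 0 ≤ C ∧
    ∀ (p : Fin n → Euc n → ℝ) (q : Euc n → ℝ), IsLowerOrder B p q →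
    ∀ U : Euc n → ℝ, ContDiff ℝ 2 U → HasCompactSupport U →
    ∀ (x₀ : Euc n) (r M : ℝ), 0 < r → r ≤ 1 →
      (∀ x ∈ closedBall x₀ r, |U x| ≤ M) →
      (∀ x ∈ closedBall x₀ r, lap U x = ∑ k, p k x * pd k U x + q x * U x) →
      ∀ y ∈ closedBall x₀ (r / 8), ∀ i j,
        |pd j (pd i U) x₀ - pd j (pd i U) y| ≤ C * M * r ^ (-(2 + α)) * dist x₀ y ^ α := by
  obtain ⟨N, hN, hest⟩ := exists_poisson_estimate n
  obtain ⟨C, hC, h_int⟩ := exists_interior_bound n hB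
  have h1α : 0 < 1 - α := by linarith
  refine ⟨N * (64 * C + B * (n + 2) * (1 + C + C) / (1 - α)), by positivity, ?_⟩
  intro p q hpq U hU hUc x₀ r M hr hr1 hM heq y hy i j
  have hM0 : 0 ≤ M := (abs_nonneg _).trans (hM x₀ (mem_closedBall_self hr.le))
  have hb := h_int p q hpq U hU hUc x₀ r M hr hr1 hM heq
  set S := closedBall x₀ (r / 2) with hS
  have hSconv : Convex ℝ S := convex_closedBall _ _
  have hSr : ∀ x ∈ S, x ∈ closedBall x₀ r := closedBall_subset_closedBall (by linarith)
  set L := B * (n + 2) * (M + C * M / r + C * M / r ^ 2) with hL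
  have hL0 : 0 ≤ L := by positivity
  have hlip : ∀ x ∈ S, ∀ z ∈ S, |lap U x - lap U z| ≤ L * dist x z := fun x hx z hz =>
    abs_lap_sub_le hpq hU hSconv (fun w hw => heq w (hSr w hw)) (fun w hw => hM w (hSr w hw))
      (fun w hw => (hb w hw).1) (fun w hw => (hb w hw).2) hx hz
  have hyd : dist y x₀ ≤ r / 8 := hy
  have hx₀S : x₀ ∈ S := mem_closedBall_self (by linarith)
  have hyS : y ∈ S := closedBall_subset_closedBall (by linarith) hy
  have hxz : ∀ z ∈ closedBall (0 : Euc n) (r / 8), x₀ - z ∈ S := by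
    intro z hz
    have hz' : ‖z‖ ≤ r / 8 := by simpa using hz
    rw [hS, mem_closedBall, dist_eq_norm]
    simp only [sub_sub_cancel_left, norm_neg]
    linarith
  have hyz : ∀ z ∈ closedBall (0 : Euc n) (r / 8), y - z ∈ S := by
    intro z hz
    have hz' : ‖z‖ ≤ r / 8 := by simpa using hz
    rw [hS, mem_closedBall]
    have h1 := dist_triangle (y - z) y x₀
    have h2 : dist (y - z) y = ‖z‖ := by simp
    linarith
  have hyball : ∀ z ∈ closedBall y (r / 8), z ∈ S := by
    intro z hz
    have h1 := dist_triangle z y x₀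
    have h2 : dist z y ≤ r / 8 := hz
    rw [hS, mem_closedBall]
    linarith
  set t := dist x₀ y with ht
  have ht0 : 0 ≤ t := dist_nonneg
  have e := (hest U hU hUc (r / 8) (by positivity)).2.2 x₀ y (C * M / r * t) L α hα0 hα1
    (by positivity) hL0
    (fun z hz => by
      have := abs_sub_le_of_gradSum_le (hU.of_le (by norm_num)) hSconv (fun w hw => (hb w hw).1)
        (hxz z hz) (hyz z hz)
      rwa [dist_sub_right] at this)
    (fun z hz => by
      have := hlip _ (hxz z hz) _ (hyz z hz)
      rwa [dist_sub_right] at this)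
    (fun z hz => hlip z (closedBall_subset_closedBall (by linarith) hz) x₀ hx₀S)
    (fun z hz => hlip z (hyball z hz) y hyS) i j
  refine e.trans ?_
  have hrp : 0 < r ^ (-(2 + α)) := by positivity
  have htr : t ≤ r ^ (1 - α) * t ^ α :=
    le_rpow_mul_rpow_of_le hr ht0 hα0 hα1 (by rw [ht, dist_comm]; linarith) le_rfl
  have hr3 : r ^ (1 - α) = r ^ 3 * r ^ (-(2 + α)) := by
    rw [← Real.rpow_natCast r 3, ← Real.rpow_add hr]
    congr 1
    push_cast
    ring
  have hr2 : (r ^ 2)⁻¹ ≤ r ^ (-(2 + α)) := by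
    rw [← Real.rpow_natCast r 2, ← Real.rpow_neg hr.le]
    exact Real.rpow_le_rpow_of_exponent_ge hr hr1 (by push_cast; linarith)
  have hK : C * M / r * t / (r / 8) ^ 2 ≤ 64 * C * M * (r ^ (-(2 + α)) * t ^ α) := by
    calc C * M / r * t / (r / 8) ^ 2 ≤ C * M / r * (r ^ (1 - α) * t ^ α) / (r / 8) ^ 2 := by
          gcongr
      _ = 64 * C * M * (r ^ (-(2 + α)) * t ^ α) := by
          rw [hr3]
          field_simp
          ring
  have hLr : L ≤ B * (n + 2) * ((1 + C + C) * M * r ^ (-(2 + α))) := by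
    have hi1 : 1 ≤ (r ^ 2)⁻¹ := (one_le_inv₀ (by positivity)).2 (pow_le_one₀ hr.le hr1)
    have hi2 : r⁻¹ ≤ (r ^ 2)⁻¹ := inv_anti₀ (by positivity) (by nlinarith)
    have h1 : M ≤ M * r ^ (-(2 + α)) := le_mul_of_one_le_right hM0 (hi1.trans hr2)
    have h2 : C * M / r ≤ C * M * r ^ (-(2 + α)) := by
      rw [div_eq_mul_inv]
      exact mul_le_mul_of_nonneg_left (hi2.trans hr2) (by positivity)
    have h3 : C * M / r ^ 2 ≤ C * M * r ^ (-(2 + α)) := by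
      rw [div_eq_mul_inv]
      exact mul_le_mul_of_nonneg_left hr2 (by positivity)
    rw [hL]
    refine mul_le_mul_of_nonneg_left ?_ (by positivity)
    linarith
  have hR1 : (r / 8) ^ (1 - α) ≤ 1 := Real.rpow_le_one (by positivity) (by linarith) h1α.le
  have hH : L * t ^ α * (r / 8) ^ (1 - α) / (1 - α)
      ≤ B * (n + 2) * (1 + C + C) / (1 - α) * M * (r ^ (-(2 + α)) * t ^ α) := by
    calc L * t ^ α * (r / 8) ^ (1 - α) / (1 - α)
        ≤ B * (n + 2) * ((1 + C + C) * M * r ^ (-(2 + α))) * t ^ α * 1 / (1 - α) := by gcongr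
      _ = B * (n + 2) * (1 + C + C) / (1 - α) * M * (r ^ (-(2 + α)) * t ^ α) := by
        field_simp
  calc N * (C * M / r * t / (r / 8) ^ 2 + L * t ^ α * (r / 8) ^ (1 - α) / (1 - α))
      ≤ N * (64 * C * M * (r ^ (-(2 + α)) * t ^ α)
        + B * (n + 2) * (1 + C + C) / (1 - α) * M * (r ^ (-(2 + α)) * t ^ α)) := by gcongr
    _ = _ := by ring

end LowerOrder

/-! ### The equation in non-divergence form -/

section Equation

variable {n : ℕ} {lam kap : ℝ} {a b : Euc n → ℝ}

theorem nonneg_of_forall_le_mul_norm (hn : 0 < n) {L : ℝ} {f : Euc n → Euc n → ℝ}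
    (h0 : ∀ x y, 0 ≤ f x y) (h : ∀ x y, f x y ≤ L * ‖x - y‖) : 0 ≤ L := by
  simpa using (h0 (EuclideanSpace.single ⟨0, hn⟩ 1) 0).trans (h (EuclideanSpace.single ⟨0, hn⟩ 1) 0)

theorem InD.bounds (hn : 0 < n) (h : InD lam kap a b) :
    (∀ x, ‖fderiv ℝ a x‖ ≤ lam) ∧ (∀ x y, ‖fderiv ℝ a x - fderiv ℝ a y‖ ≤ lam * dist x y) ∧
      (∀ x, |b x| ≤ kap) ∧ ∀ x y, |b x - b y| ≤ kap * dist x y := by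
  obtain ⟨-, -, ⟨A₀, A₁, L, h₀, h₁, h₂, hle⟩, -, B₀, L', k₀, k₁, kle⟩ := h
  have hL : 0 ≤ L := nonneg_of_forall_le_mul_norm hn (fun _ _ => norm_nonneg _) h₂
  have hL' : 0 ≤ L' := nonneg_of_forall_le_mul_norm hn (fun _ _ => abs_nonneg _) k₁
  have hA₀ : 0 ≤ A₀ := (abs_nonneg _).trans (h₀ 0)
  have hA₁ : 0 ≤ A₁ := (norm_nonneg _).trans (h₁ 0)
  have hB₀ : 0 ≤ B₀ := (abs_nonneg _).trans (k₀ 0)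
  refine ⟨fun x => (h₁ x).trans (by linarith), fun x y => (h₂ x y).trans ?_,
    fun x => (k₀ x).trans (by linarith), fun x y => (k₁ x y).trans ?_⟩
  all_goals
    rw [← dist_eq_norm]
    gcongr
    linarith

theorem abs_div_le_of_inv_le (hlam : 0 < lam) {s t F : ℝ} (ht : lam⁻¹ ≤ t) (hs : |s| ≤ F) :
    |s / t| ≤ lam * F := by
  have ht0 : 0 < t := (inv_pos.2 hlam).trans_le ht
  rw [abs_div, abs_of_pos ht0, div_eq_inv_mul]
  have : t⁻¹ ≤ lam := inv_le_of_inv_le₀ hlam ht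
  gcongr

theorem abs_div_sub_div_le (hlam : 0 < lam) {s s' t t' F G H : ℝ} (ht : lam⁻¹ ≤ t)
    (ht' : lam⁻¹ ≤ t') (hs' : |s'| ≤ F) (hG : |s - s'| ≤ G) (hH : |t - t'| ≤ H) :
    |s / t - s' / t'| ≤ lam * G + lam ^ 2 * (F * H) := by
  have ht0 : 0 < t := (inv_pos.2 hlam).trans_le ht
  have ht0' : 0 < t' := (inv_pos.2 hlam).trans_le ht'
  have key : s / t - s' / t' = (s - s') / t - (s' * (t - t')) / t / t' := by
    field_simp
    ring
  rw [key]
  refine (abs_sub _ _).trans (add_le_add (abs_div_le_of_inv_le hlam ht hG) ?_)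
  rw [sq, mul_assoc]
  refine abs_div_le_of_inv_le hlam ht' (abs_div_le_of_inv_le hlam ht ?_)
  rw [abs_mul]
  gcongr
  exact (abs_nonneg _).trans hs'

theorem InD.isLowerOrder (hn : 0 < n) (hlam : 1 < lam) (hkap : 1 < kap) (h : InD lam kap a b) :
    IsLowerOrder ((lam + lam ^ 3) * (lam + kap)) (fun k x => -pd k a x / a x)
      (fun x => b x / a x) := by
  obtain ⟨ha₁, ha₂, hb₀, hb₁⟩ := h.bounds hn
  obtain ⟨hac, hai, -⟩ := h
  have hl0 : 0 < lam := by linarith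
  have hk0 : 0 < kap := by linarith
  have halip : ∀ x y, |a x - a y| ≤ lam * dist x y := fun x y => by
    have := Convex.norm_image_sub_le_of_norm_fderiv_le (𝕜 := ℝ) (f := a) (s := univ)
      (fun z _ => hac.differentiable (by norm_num) z) (fun z _ => ha₁ z) convex_univ
      (mem_univ y) (mem_univ x)
    rwa [Real.norm_eq_abs, ← dist_eq_norm] at this
  have hpd : ∀ k x, |-pd k a x| ≤ lam := fun k x => by
    rw [abs_neg]
    exact (abs_pd_le_norm_fderiv a x k).trans (ha₁ x)
  have hpdlip : ∀ k x y, |-pd k a x - -pd k a y| ≤ lam * dist x y := fun k x y => by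
    have h1 : |fderiv ℝ a x (EuclideanSpace.single k 1) - fderiv ℝ a y (EuclideanSpace.single k 1)|
        ≤ ‖fderiv ℝ a x - fderiv ℝ a y‖ := by
      simpa using (fderiv ℝ a x - fderiv ℝ a y).le_opNorm (EuclideanSpace.single k 1)
    rw [neg_sub_neg, abs_sub_comm]
    exact h1.trans (ha₂ x y)
  have size : ∀ {F : ℝ}, 0 ≤ F → F ≤ lam + kap →
      lam * F ≤ (lam + lam ^ 3) * (lam + kap) := fun {F} hF hle => by
    have : 0 ≤ lam ^ 3 := by positivity
    gcongr
    linarith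
  have size' : ∀ {F d : ℝ}, 0 ≤ F → F ≤ lam + kap → 0 ≤ d →
      lam * (F * d) + lam ^ 2 * (F * (lam * d)) ≤ (lam + lam ^ 3) * (lam + kap) * d :=
    fun {F d} hF hle hd => by
    rw [show lam * (F * d) + lam ^ 2 * (F * (lam * d)) = (lam + lam ^ 3) * F * d by ring]
    gcongr
  refine ⟨fun k x => ?_, fun k x y => ?_, fun x => ?_, fun x y => ?_⟩
  · exact (abs_div_le_of_inv_le hl0 (hai x) (hpd k x)).trans (size hl0.le (by linarith))
  · exact (abs_div_sub_div_le hl0 (hai x) (hai y) (hpd k y) (hpdlip k x y) (halip x y)).trans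
      (size' hl0.le (by linarith) dist_nonneg)
  · exact (abs_div_le_of_inv_le hl0 (hai x) (hb₀ x)).trans (size hk0.le (by linarith))
  · exact (abs_div_sub_div_le hl0 (hai x) (hai y) (hb₀ y) (hb₁ x y) (halip x y)).trans
      (size' hk0.le (by linarith) dist_nonneg)

theorem gradient_apply (u : Euc n → ℝ) (x : Euc n) (i : Fin n) : gradient u x i = pd i u x := by
  have h : inner ℝ (gradient u x) (EuclideanSpace.single i (1 : ℝ)) = pd i u x := by
    simp [gradient, pd]
  rw [← h, EuclideanSpace.inner_single_right]
  simp

theorem vdiv_smul_gradient {u : Euc n → ℝ} {x : Euc n} (ha : DifferentiableAt ℝ a x)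
    (hu : ContDiffAt ℝ 2 u x) :
    vdiv (fun y => a y • gradient u y) x
      = ∑ i, (a x * pd i (pd i u) x + pd i u x * pd i a x) := by
  have hgrad : ∀ i, DifferentiableAt ℝ (pd i u) x := fun i => by
    have hd : DifferentiableAt ℝ (fderiv ℝ u) x :=
      (hu.fderiv_right (m := 1) (by norm_num)).differentiableAt (by norm_num)
    exact hd.clm_apply (differentiableAt_const _)
  have hcoord : ∀ i, (fun y => (a y • gradient u y) i) = fun y => a y * pd i u y := fun i => by
    funext y
    simp [gradient_apply]
  have hF : DifferentiableAt ℝ (fun y => a y • gradient u y) x := by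
    rw [differentiableAt_euclidean]
    intro i
    rw [hcoord]
    exact ha.mul (hgrad i)
  unfold vdiv
  refine Finset.sum_congr rfl fun i _ => ?_
  rw [← pd_mul ha (hgrad i), ← hcoord]
  have := ((EuclideanSpace.proj i : Euc n →L[ℝ] ℝ).hasFDerivAt.comp x hF.hasFDerivAt).fderiv
  have h2 : ((EuclideanSpace.proj i : Euc n →L[ℝ] ℝ) ∘ fun y => a y • gradient u y)
      = fun y => (a y • gradient u y) i := rfl
  rw [h2] at this
  unfold pd
  rw [this]
  rfl

theorem lap_eq_of_vdiv_eq {u : Euc n → ℝ} {x : Euc n} (ha : DifferentiableAt ℝ a x)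
    (hax : a x ≠ 0) (hu : ContDiffAt ℝ 2 u x)
    (h : -vdiv (fun y => a y • gradient u y) x + b x * u x = 0) :
    lap u x = ∑ k, -pd k a x / a x * pd k u x + b x / a x * u x := by
  rw [vdiv_smul_gradient ha hu, Finset.sum_add_distrib, ← Finset.mul_sum] at h
  have h1 : ∑ k, -pd k a x / a x * pd k u x = -(∑ k, pd k u x * pd k a x) / a x := by
    rw [← Finset.sum_neg_distrib, Finset.sum_div]
    exact Finset.sum_congr rfl fun k _ => by ring
  rw [h1]
  unfold lap
  field_simp
  linarith

end Equation

/-! ### Localization -/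

theorem exists_cutoff {n : ℕ} {u : Euc n → ℝ} {ξ x₀ : Euc n} {r : ℝ} (hr : 0 < r)
    (hξ : 2 * r ≤ dist x₀ ξ) (hu : ContDiffOn ℝ 2 u {ξ}ᶜ) :
    ∃ U : Euc n → ℝ, ContDiff ℝ 2 U ∧ HasCompactSupport U ∧
      ∀ x ∈ closedBall x₀ r, U =ᶠ[nhds x] u := by
  let f : ContDiffBump x₀ := ⟨5 * r / 4, 3 * r / 2, by positivity, by linarith⟩
  refine ⟨fun x => f x * u x, contDiff_iff_contDiffAt.2 fun x => ?_, f.hasCompactSupport.mul_right,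
    fun x hx => ?_⟩
  · by_cases hx : x = ξ
    · have hfar : ∀ᶠ y in nhds x, y ∈ (closedBall x₀ (3 * r / 2))ᶜ := by
        refine isClosed_closedBall.isOpen_compl.mem_nhds ?_
        rw [mem_compl_iff, mem_closedBall, hx, dist_comm]
        linarith
      have : (fun y => f y * u y) =ᶠ[nhds x] fun _ => 0 := by
        filter_upwards [hfar] with y hy
        rw [f.zero_of_le_dist, zero_mul]
        simpa [f] using (not_le.1 (mt mem_closedBall.2 hy)).le
      exact contDiffAt_const.congr_of_eventuallyEq this
    · exact f.contDiff.contDiffAt.mul (hu.contDiffAt (isOpen_compl_singleton.mem_nhds hx))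
  · have hx' : x ∈ ball x₀ f.rIn := by
      rw [mem_ball]
      have := mem_closedBall.1 hx
      simp only [f]
      linarith
    filter_upwards [f.eventuallyEq_one_of_mem_ball hx'] with y hy
    simp [hy]

theorem exists_local_estimate (n : ℕ) (hn : 0 < n) {lam kap α : ℝ} (hlam : 1 < lam)
    (hkap : 1 < kap) (hα0 : 0 < α) (hα1 : α < 1) : ∃ C : ℝ, 0 ≤ C ∧
    ∀ a b : Euc n → ℝ, InD lam kap a b → ∀ ξ : Euc n, ∀ u : Euc n → ℝ, ContDiffOn ℝ 2 u {ξ}ᶜ →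
      (∀ x ∈ ({ξ}ᶜ : Set (Euc n)), -vdiv (fun y => a y • gradient u y) x + b x * u x = 0) →
      ∀ (x₀ : Euc n) (r M : ℝ), 0 < r → r ≤ 1 → 2 * r ≤ dist x₀ ξ →
      (∀ x ∈ closedBall x₀ r, |u x| ≤ M) →
      (∀ i, |pd i u x₀| ≤ C * M / r) ∧ (∀ i j, |pd i (pd j u) x₀| ≤ C * M / r ^ 2) ∧
        ∀ y ∈ closedBall x₀ (r / 8), ∀ i j, |pd i (pd j u) x₀ - pd i (pd j u) y|
          ≤ C * M * r ^ (-(2 + α)) * dist x₀ y ^ α := by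
  have hB : 0 ≤ (lam + lam ^ 3) * (lam + kap) := by positivity
  obtain ⟨C₁, hC₁, h₁⟩ := exists_interior_bound n hB
  obtain ⟨C₂, hC₂, h₂⟩ := exists_interior_holder n hB hα0 hα1
  refine ⟨C₁ + C₂, by positivity, fun a b hab ξ u hu heq x₀ r M hr hr1 hξ hM => ?_⟩
  obtain ⟨U, hU, hUc, hUu⟩ := exists_cutoff hr hξ hu
  have hM0 : 0 ≤ M := (abs_nonneg _).trans (hM x₀ (mem_closedBall_self hr.le))
  have hpq := hab.isLowerOrder hn hlam hkap
  have hpd : ∀ x ∈ closedBall x₀ r, ∀ i, pd i U x = pd i u x := fun x hx i =>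
    pd_congr_of_eventuallyEq (hUu x hx) i
  have hpdpd : ∀ x ∈ closedBall x₀ r, ∀ i j, pd i (pd j U) x = pd i (pd j u) x := fun x hx i j =>
    pd_congr_of_eventuallyEq (pd_eventuallyEq (hUu x hx) j) i
  have hUM : ∀ x ∈ closedBall x₀ r, |U x| ≤ M := fun x hx => by
    rw [(hUu x hx).eq_of_nhds]
    exact hM x hx
  have hlap : ∀ x ∈ closedBall x₀ r,
      lap U x = ∑ k, -pd k a x / a x * pd k U x + b x / a x * U x := fun x hx => by
    have hxξ : x ≠ ξ := by
      rintro rfl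
      have := mem_closedBall'.1 hx
      linarith
    have hax : a x ≠ 0 := ((inv_pos.2 (one_pos.trans hlam)).trans_le (hab.2.1 x)).ne'
    have := lap_eq_of_vdiv_eq (hab.1.differentiable (by norm_num) x) hax
      (hu.contDiffAt (isOpen_compl_singleton.mem_nhds hxξ)) (heq x hxξ)
    simp only [lap, hpd x hx, hpdpd x hx, (hUu x hx).eq_of_nhds]
    exact this
  have hx₀ : x₀ ∈ closedBall x₀ (r / 2) := mem_closedBall_self (by positivity)
  have hx₀' : x₀ ∈ closedBall x₀ r := mem_closedBall_self hr.le
  obtain ⟨hg, hh⟩ := h₁ _ _ hpq U hU hUc x₀ r M hr hr1 hUM hlap x₀ hx₀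
  refine ⟨fun i => ?_, fun i j => ?_, fun y hy i j => ?_⟩
  · rw [← hpd x₀ hx₀']
    refine ((abs_pd_le_gradSum U x₀ i).trans hg).trans ?_
    gcongr
    linarith
  · rw [← hpdpd x₀ hx₀']
    refine (((abs_pd_le_gradSum _ x₀ i).trans (gradSum_pd_le_hessSum U x₀ j)).trans hh).trans ?_
    gcongr
    linarith
  · have hy' : y ∈ closedBall x₀ r := closedBall_subset_closedBall (by linarith) hy
    rw [← hpdpd x₀ hx₀', ← hpdpd y hy']
    refine (h₂ _ _ hpq U hU hUc x₀ r M hr hr1 hUM hlap y hy j i).trans ?_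
    gcongr
    linarith

theorem inv_pow_le_rpow_neg {r α : ℝ} (hr : 0 < r) (hr1 : r ≤ 1) (hα0 : 0 < α) {k : ℕ}
    (hk : k ≤ 2) : (r ^ k)⁻¹ ≤ r ^ (-(2 + α)) := by
  rw [← Real.rpow_natCast, ← Real.rpow_neg hr.le]
  refine Real.rpow_le_rpow_of_exponent_ge hr hr1 (neg_le_neg ?_)
  have : (k : ℝ) ≤ 2 := by exact_mod_cast hk
  linarith

theorem abs_sub_le_of_lt_dist {r α d T s t : ℝ} (hr : 0 < r) (hα0 : 0 < α) (hα1 : α < 1)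
    (hd : r / 8 < d) (hs : |s| ≤ T / r ^ 2) (ht : |t| ≤ T / r ^ 2) :
    |s - t| ≤ 16 * T * r ^ (-(2 + α)) * d ^ α := by
  have hT : 0 ≤ T / r ^ 2 := (abs_nonneg _).trans hs
  have hd0 : 0 < d := by linarith [div_pos hr (by norm_num : (0 : ℝ) < 8)]
  have hE : r ^ (-(2 + α)) = (r ^ 2)⁻¹ * (r ^ α)⁻¹ := by
    rw [neg_add, Real.rpow_add hr, Real.rpow_neg hr.le, Real.rpow_neg hr.le]
    norm_num
  have h1 : 1 ≤ 8 * (d ^ α / r ^ α) := by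
    rw [← Real.div_rpow hd0.le hr.le]
    have h8 : (8 : ℝ)⁻¹ ≤ d / r := by
      rw [le_div_iff₀ hr]
      linarith
    have h2 : (8 : ℝ)⁻¹ ≤ (d / r) ^ α := by
      refine le_trans ?_ (Real.rpow_le_rpow (by norm_num) h8 hα0.le)
      exact Real.self_le_rpow_of_le_one (by norm_num) (by norm_num) hα1.le
    linarith
  calc |s - t| ≤ 2 * (T / r ^ 2) * 1 := by linarith [abs_sub s t]
    _ ≤ 2 * (T / r ^ 2) * (8 * (d ^ α / r ^ α)) := by gcongr
    _ = 16 * T * r ^ (-(2 + α)) * d ^ α := by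
      rw [hE]
      ring

/-! ### Assembly of the norm -/

theorem supAbs_le {n : ℕ} {K : Set (Euc n)} {f : Euc n → ℝ} {D : ℝ} (h : ∀ x ∈ K, |f x| ≤ D) :
    supAbs K f ≤ ENNReal.ofReal D :=
  iSup₂_le fun x hx => ENNReal.ofReal_le_ofReal (h x hx)

theorem holderSemi_le {n : ℕ} {α : ℝ} {K : Set (Euc n)} {f : Euc n → ℝ} {D : ℝ} (hD : 0 ≤ D)
    (h : ∀ x ∈ K, ∀ y ∈ K, |f x - f y| ≤ D * dist x y ^ α) :
    holderSemi α K f ≤ ENNReal.ofReal D :=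
  iSup₂_le fun x hx => iSup₂_le fun y hy => ENNReal.ofReal_le_ofReal <|
    div_le_of_le_mul₀ (Real.rpow_nonneg dist_nonneg _) hD (h x hx y hy)

theorem C2alphaNorm_le {n : ℕ} {α : ℝ} {K : Set (Euc n)} {w : Euc n → ℝ} {D : ℝ} (hD : 0 ≤ D)
    (h₀ : ∀ x ∈ K, |w x| ≤ D) (h₁ : ∀ x ∈ K, ∀ i, |pd i w x| ≤ D)
    (h₂ : ∀ x ∈ K, ∀ i j, |pd i (pd j w) x| ≤ D)
    (h₃ : ∀ x ∈ K, ∀ y ∈ K, ∀ i j,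
      |pd i (pd j w) x - pd i (pd j w) y| ≤ D * dist x y ^ α) :
    C2alphaNorm α K w ≤ ENNReal.ofReal ((1 + n + 2 * n ^ 2) * D) := by
  have e₁ : ∑ i, supAbs K (pd i w) ≤ n * ENNReal.ofReal D := by
    refine (Finset.sum_le_sum fun i _ => supAbs_le fun x hx => h₁ x hx i).trans ?_
    simp
  have e₂ : ∑ i, ∑ j, supAbs K (pd i (pd j w)) ≤ n * (n * ENNReal.ofReal D) := by
    refine (Finset.sum_le_sum fun i _ => Finset.sum_le_sum fun j _ =>
      supAbs_le fun x hx => h₂ x hx i j).trans ?_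
    simp
  have e₃ : ∑ i, ∑ j, holderSemi α K (pd i (pd j w)) ≤ n * (n * ENNReal.ofReal D) := by
    refine (Finset.sum_le_sum fun i _ => Finset.sum_le_sum fun j _ =>
      holderSemi_le hD fun x hx y hy => h₃ x hx y hy i j).trans ?_
    simp
  refine (add_le_add (add_le_add (add_le_add (supAbs_le h₀) e₁) e₂) e₃).trans (le_of_eq ?_)
  rw [← ENNReal.ofReal_natCast, ← ENNReal.ofReal_mul (by positivity),
    ← ENNReal.ofReal_mul (by positivity), ← ENNReal.ofReal_add hD (by positivity),
    ← ENNReal.ofReal_add (by positivity) (by positivity),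
    ← ENNReal.ofReal_add (by positivity) (by positivity)]
  congr 1
  ring

theorem C2alphaNorm_le_of_local_estimate {n : ℕ} {α r M C : ℝ} {K : Set (Euc n)} {w : Euc n → ℝ}
    (hα0 : 0 < α) (hα1 : α < 1) (hr : 0 < r) (hr1 : r ≤ 1) (hC : 0 ≤ C) (hM : 0 ≤ M)
    (h₀ : ∀ x ∈ K, |w x| ≤ M) (h₁ : ∀ x ∈ K, ∀ i, |pd i w x| ≤ C * M / r)
    (h₂ : ∀ x ∈ K, ∀ i j, |pd i (pd j w) x| ≤ C * M / r ^ 2)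
    (h₃ : ∀ x ∈ K, ∀ y ∈ closedBall x (r / 8), ∀ i j,
      |pd i (pd j w) x - pd i (pd j w) y| ≤ C * M * r ^ (-(2 + α)) * dist x y ^ α) :
    C2alphaNorm α K w
      ≤ ENNReal.ofReal ((1 + n + 2 * n ^ 2) * ((16 * C + 1) * M * r ^ (-(2 + α)))) := by
  have hE := fun {k : ℕ} (hk : k ≤ 2) => inv_pow_le_rpow_neg hr hr1 hα0 hk
  have hE0 : 0 ≤ r ^ (-(2 + α)) := by positivity
  have hCM : 0 ≤ C * M := by positivity
  have hCME : C * M * r ^ (-(2 + α)) ≤ (16 * C + 1) * M * r ^ (-(2 + α)) := by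
    gcongr
    linarith
  refine C2alphaNorm_le (by positivity) (fun x hx => (h₀ x hx).trans ?_)
    (fun x hx i => (h₁ x hx i).trans ?_) (fun x hx i j => (h₂ x hx i j).trans ?_)
    fun x hx y hy i j => ?_
  · have h1 : 1 ≤ r ^ (-(2 + α)) := by simpa using hE (k := 0) (by norm_num)
    calc M = 1 * M * 1 := by ring
      _ ≤ _ := by
        gcongr
        linarith
  · refine le_trans ?_ hCME
    rw [div_eq_mul_inv]
    exact mul_le_mul_of_nonneg_left (by simpa using hE (k := 1) (by norm_num)) hCM
  · refine le_trans ?_ hCME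
    rw [div_eq_mul_inv]
    exact mul_le_mul_of_nonneg_left (hE le_rfl) hCM
  · rcases le_or_gt (dist x y) (r / 8) with hxy | hxy
    · refine (h₃ x hx y (mem_closedBall'.2 hxy) i j).trans ?_
      gcongr
    · refine (abs_sub_le_of_lt_dist hr hα0 hα1 hxy (h₂ x hx i j) (h₂ y hy i j)).trans ?_
      rw [← mul_assoc]
      gcongr
      linarith

theorem rpow_min_one_half_le {ϱ α : ℝ} (hϱ : 0 < ϱ) (hα0 : 0 < α) (hα1 : α < 1) :
    min 1 (ϱ / 2) ^ (-(2 + α)) ≤ 8 * max (ϱ ^ (-(2 + α))) 1 := by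
  have hmax : 1 ≤ max (ϱ ^ (-(2 + α))) 1 := le_max_right _ _
  rcases min_choice 1 (ϱ / 2) with h | h
  · rw [h, Real.one_rpow]
    linarith
  · rw [h, Real.div_rpow hϱ.le (by norm_num), Real.rpow_neg (by norm_num : (0 : ℝ) ≤ 2),
      div_inv_eq_mul, mul_comm]
    have h2 : (2 : ℝ) ^ (2 + α) ≤ 8 := by
      calc (2 : ℝ) ^ (2 + α) ≤ 2 ^ (3 : ℝ) :=
            Real.rpow_le_rpow_of_exponent_le (by norm_num) (by linarith)
        _ = 8 := by norm_num
    exact mul_le_mul h2 (le_max_left _ _) (by positivity) (by norm_num)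

theorem exp_mul_rpow_le {n : ℕ} (hn : 2 ≤ n) {C₀ s t ϱ : ℝ} (hC₀ : 0 ≤ C₀) (hϱ : 0 < ϱ)
    (ht : ϱ / 2 ≤ t) (hs : 0 ≤ s) :
    C₀ * Real.exp (-t / s) * t ^ ((2 : ℝ) - n) ≤ C₀ * 2 ^ n * ϱ ^ ((2 : ℝ) - n) := by
  have ht0 : 0 < t := (half_pos hϱ).trans_le ht
  have hn' : (2 : ℝ) ≤ n := by exact_mod_cast hn
  have h1 : Real.exp (-t / s) ≤ 1 :=
    Real.exp_le_one_iff.2 (div_nonpos_of_nonpos_of_nonneg (by linarith) hs)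
  have h2 : t ^ ((2 : ℝ) - n) ≤ 2 ^ n * ϱ ^ ((2 : ℝ) - n) := by
    calc t ^ ((2 : ℝ) - n) ≤ (ϱ / 2) ^ ((2 : ℝ) - n) :=
          Real.rpow_le_rpow_of_nonpos (half_pos hϱ) ht (by linarith)
      _ = 2 ^ ((n : ℝ) - 2) * ϱ ^ ((2 : ℝ) - n) := by
        rw [Real.div_rpow hϱ.le (by norm_num), ← neg_sub (n : ℝ) 2,
          Real.rpow_neg (by norm_num : (0 : ℝ) ≤ 2), div_inv_eq_mul, mul_comm]
      _ ≤ 2 ^ n * ϱ ^ ((2 : ℝ) - n) := by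
        gcongr
        rw [← Real.rpow_natCast]
        exact Real.rpow_le_rpow_of_exponent_le (by norm_num) (by linarith)
  calc C₀ * Real.exp (-t / s) * t ^ ((2 : ℝ) - n)
      ≤ C₀ * 1 * (2 ^ n * ϱ ^ ((2 : ℝ) - n)) := by gcongr
    _ = _ := by ring

theorem one_le_Lam {lam α h : ℝ} (hlam : 1 < lam) (hh : 0 ≤ h) : 1 ≤ Lam lam α h := by
  have h1 : 0 ≤ h * (1 + h) * (1 + h ^ α) := by positivity
  unfold Lam
  nlinarith

/-- `C^{2,α}` bounds for a solution of `L_{a,b} u = 0` away from a point source,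
satisfying the upper fundamental-solution bound. -/
theorem stmt4 (n : ℕ) (hn : 3 ≤ n) (α : ℝ) (hα0 : 0 < α) (hα1 : α < 1) :
    ∃ ϰ > (2 : ℝ),
      ∀ (lam kap C₀ c₀ : ℝ), 1 < lam → 1 < kap → 1 ≤ C₀ → 1 ≤ c₀ →
      ∃ C > (0 : ℝ),
        ∀ a b : Euc n → ℝ, InD lam kap a b →
        ∀ ξ : Euc n, ∀ u : Euc n → ℝ,
          ContDiffOn ℝ 2 u {ξ}ᶜ →
          (∀ x ∈ ({ξ}ᶜ : Set (Euc n)), ∃ s ∈ nhds x, s ⊆ {ξ}ᶜ ∧ ∀ i j : Fin n,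
              ∃ c : NNReal, HolderOnWith c α.toNNReal (pd i (pd j u)) s) →
          (∀ x ∈ ({ξ}ᶜ : Set (Euc n)),
              -vdiv (fun y => a y • gradient u y) x + b x * u x = 0) →
          (∀ x : Euc n, x ≠ ξ →
              |u x| ≤ C₀ * Real.exp (-dist x ξ / Real.sqrt (c₀ * kap))
                        * dist x ξ ^ ((2:ℝ) - n)) →
        ∀ 𝒪 : Set (Euc n), IsOpen 𝒪 → Bornology.IsBounded 𝒪 → ξ ∉ closure 𝒪 →
          C2alphaNorm α (closure 𝒪) u
            ≤ ENNReal.ofReal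
                (C * Lam lam α (Metric.diam 𝒪 + infDist ξ (closure 𝒪)) ^ ϰ
                  * max (infDist ξ (closure 𝒪) ^ (-(2 + α))) 1
                  * infDist ξ (closure 𝒪) ^ ((2:ℝ) - n)) := by
  refine ⟨3, by norm_num, fun lam kap C₀ c₀ hlam hkap hC₀ hc₀ => ?_⟩
  obtain ⟨C, hC, hloc⟩ := exists_local_estimate n (by omega) hlam hkap hα0 hα1
  refine ⟨(1 + n + 2 * n ^ 2) * ((16 * C + 1) * (C₀ * 2 ^ n) * 8), by positivity,
    fun a b hab ξ u hu _ heq hub 𝒪 _ _ hξ => ?_⟩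
  rcases (closure 𝒪).eq_empty_or_nonempty with hemp | hne
  · simp [hemp, C2alphaNorm, supAbs, holderSemi]
  have hϱ : 0 < infDist ξ (closure 𝒪) := (isClosed_closure.notMem_iff_infDist_pos hne).1 hξ
  have hLam := one_le_Lam (α := α) hlam
    (add_nonneg (diam_nonneg (s := 𝒪)) (infDist_nonneg (x := ξ) (s := closure 𝒪)))
  set ϱ := infDist ξ (closure 𝒪)
  set Λ := Lam lam α (diam 𝒪 + ϱ)
  have hr : 0 < min 1 (ϱ / 2) := lt_min one_pos (half_pos hϱ)
  have hdist : ∀ x ∈ closure 𝒪, ϱ ≤ dist x ξ := fun x hx => by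
    rw [dist_comm]
    exact infDist_le_dist_of_mem hx
  have hbound : ∀ x ∈ closure 𝒪, ∀ y ∈ closedBall x (min 1 (ϱ / 2)),
      |u y| ≤ C₀ * 2 ^ n * ϱ ^ ((2 : ℝ) - n) := fun x hx y hy => by
    have hy' : ϱ / 2 ≤ dist y ξ := by
      have h1 := (mem_closedBall'.1 hy).trans (min_le_right _ _)
      linarith [hdist x hx, dist_triangle x y ξ]
    have hyξ : y ≠ ξ := dist_pos.1 ((half_pos hϱ).trans_le hy')
    exact (hub y hyξ).trans
      (exp_mul_rpow_le (by omega) (by linarith) hϱ hy' (Real.sqrt_nonneg _))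
  have hest := fun x hx => hloc a b hab ξ u hu heq x (min 1 (ϱ / 2)) _ hr (min_le_left _ _)
    (by linarith [hdist x hx, min_le_right 1 (ϱ / 2)]) (hbound x hx)
  refine (C2alphaNorm_le_of_local_estimate hα0 hα1 hr (min_le_left _ _) hC (by positivity)
    (fun x hx => hbound x hx x (mem_closedBall_self hr.le)) (fun x hx => (hest x hx).1)
    (fun x hx => (hest x hx).2.1) fun x hx => (hest x hx).2.2).trans
      (ENNReal.ofReal_le_ofReal ?_)
  have hΛ : 1 ≤ Λ ^ (3 : ℝ) := Real.one_le_rpow hLam (by norm_num)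
  calc (1 + n + 2 * n ^ 2)
        * ((16 * C + 1) * (C₀ * 2 ^ n * ϱ ^ ((2 : ℝ) - n)) * min 1 (ϱ / 2) ^ (-(2 + α)))
      ≤ (1 + n + 2 * n ^ 2)
        * ((16 * C + 1) * (C₀ * 2 ^ n * ϱ ^ ((2 : ℝ) - n))
          * (8 * max (ϱ ^ (-(2 + α))) 1)) := by
        gcongr
        exact rpow_min_one_half_le hϱ hα0 hα1
    _ = (1 + n + 2 * n ^ 2) * ((16 * C + 1) * (C₀ * 2 ^ n) * 8) * 1
          * max (ϱ ^ (-(2 + α))) 1 * ϱ ^ ((2 : ℝ) - n) := by ring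
    _ ≤ (1 + n + 2 * n ^ 2) * ((16 * C + 1) * (C₀ * 2 ^ n) * 8) * Λ ^ (3 : ℝ)
          * max (ϱ ^ (-(2 + α))) 1 * ϱ ^ ((2 : ℝ) - n) := by gcongr

end
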